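/- arXiv:1210.8253 — 2 statements merged into one kernel-verified Lean document; each statement's English description precedes it below -/
import Mathlib

section
/- For every integer m ≥ 4 and every integer r with 2^m − 1 − m ≤ r ≤ 2^m − 1, excluding the cases (m,r) = (6,63), (m,r) = (7,126), (m,r) = (7,127) and (m,r) = (11,2047), there exists a propelinear perfect binary code C of length n = 2^m − 1 containing the all-zero vector whose rank equals r. -/
open Finset

/-- The binary vector space `F^n`. -/
abbrev F (n : ℕ) : Type := Fin n → ZMod 2

/-- Action of a coordinate permutation: `(π x) i = x (π⁻¹ i)`. -/
def permAct {n : ℕ} (π : Equiv.Perm (Fin n)) (x : F n) : F n := fun i => x (π⁻¹ i)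

/-- `(v, π)` is an isometry fixing the code `C` set-wise. -/
def IsIsoPair {n : ℕ} (C : Set (F n)) (v : F n) (π : Equiv.Perm (Fin n)) : Prop :=
  (fun x => v + permAct π x) '' C = C

/-- `C` is a single-error-correcting perfect binary code. -/
def IsPerfectCode {n : ℕ} (C : Set (F n)) : Prop :=
  ∀ x : F n, ∃! y : F n, y ∈ C ∧ hammingDist x y ≤ 1

/-- `P` is a propelinear structure on the code `C`. -/
def IsPropStructure {n : ℕ} (C : Set (F n)) (P : F n → Equiv.Perm (Fin n)) : Prop :=
  (∀ x ∈ C, IsIsoPair C x (P x)) ∧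
  (∀ x ∈ C, ∀ y ∈ C, P (x + permAct (P x) y) = P x * P y)

/-- `C` admits a propelinear structure. -/
def IsPropelinear {n : ℕ} (C : Set (F n)) : Prop :=
  ∃ P : F n → Equiv.Perm (Fin n), IsPropStructure C P

/-- The rank of a code: dimension of its linear span over GF(2). -/
noncomputable def codeRank {n : ℕ} (C : Set (F n)) : ℕ :=
  Module.finrank (ZMod 2) (Submodule.span (ZMod 2) C)

/-- The kernel of a code `C`: codewords whose translate fixes `C`. -/
def codeKernel {n : ℕ} (C : Set (F n)) : Set (F n) :=
  {x ∈ C | (fun c => x + c) '' C = C}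

/-- A propelinear structure is normalized if codewords in the same coset
of the kernel get the same permutation. -/
def IsNormalized {n : ℕ} (C : Set (F n)) (P : F n → Equiv.Perm (Fin n)) : Prop :=
  ∀ x ∈ C, ∀ y ∈ C, x + y ∈ codeKernel C → P x = P y

/-- A code is transitive if its automorphism group acts transitively on it. -/
def IsTransitive {n : ℕ} (C : Set (F n)) : Prop :=
  ∀ x ∈ C, ∀ y ∈ C, ∃ v π, IsIsoPair C v π ∧ v + permAct π x = y

/-- The (ZMod 2) weight parity `|x| = Σ_i x_i`. -/
def wt {n : ℕ} (x : F n) : ZMod 2 := ∑ i, x i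

/-- Assemble a vector of `F^(2n+1)` from a first block of `n` coordinates,
a middle coordinate and a last block of `n` coordinates. -/
def vasVec {n : ℕ} (a : F n) (b : ZMod 2) (c : F n) : F (2 * n + 1) :=
  fun i =>
    if h : (i : ℕ) < n then a ⟨i, h⟩
    else if h' : (i : ℕ) = n then b
    else c ⟨(i : ℕ) - (n + 1), by have := i.isLt; omega⟩

/-- The Vasil'ev code of `C` with function `lam`. -/
def vasCode {n : ℕ} (C : Set (F n)) (lam : F n → ZMod 2) : Set (F (2 * n + 1)) :=
  {w | ∃ x : F n, ∃ y ∈ C, w = vasVec (x + y) (wt x + lam y) x}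

/-- Assemble a vector of `F^(tm+t+m)` from blocks of `tm`, `t` and `m` coordinates. -/
def mollVec {t m : ℕ} (x : F (t * m)) (b : F t) (c : F m) : F (t * m + t + m) :=
  fun i =>
    if h : (i : ℕ) < t * m then x ⟨i, h⟩
    else if h' : (i : ℕ) < t * m + t then b ⟨(i : ℕ) - t * m, by omega⟩
    else c ⟨(i : ℕ) - (t * m + t), by have := i.isLt; omega⟩

/-- First generalized parity-check function: `p1(x)_i = Σ_j x_{ij}`. -/
def p1 {t m : ℕ} (x : F (t * m)) : F t := fun i => ∑ j : Fin m, x (finProdFinEquiv (i, j))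

/-- Second generalized parity-check function: `p2(x)_j = Σ_i x_{ij}`. -/
def p2 {t m : ℕ} (x : F (t * m)) : F m := fun j => ∑ i : Fin t, x (finProdFinEquiv (i, j))

/-- The Mollard code of `Ct` and `Cm` with function `f`. -/
def mollCode {t m : ℕ} (Ct : Set (F t)) (Cm : Set (F m)) (f : F t → F m) :
    Set (F (t * m + t + m)) :=
  {w | ∃ x : F (t * m), ∃ y ∈ Ct, ∃ z ∈ Cm, w = mollVec x (y + p1 x) (z + p2 x + f y)}

namespace PPC

open Finset

set_option linter.unusedSectionVars false
set_option linter.unusedVariables false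

section gen
variable {ι : Type} [Fintype ι] [DecidableEq ι]

/-- coordinate permutation action on an arbitrary index type -/
def act {ι : Type} (σ : Equiv.Perm ι) (x : ι → ZMod 2) : ι → ZMod 2 := fun i => x (σ⁻¹ i)

/-- error vectors -/
def err {ι : Type} [DecidableEq ι] : Option ι → ι → ZMod 2
  | none => 0
  | some i => Pi.single i 1

theorem act_add (σ : Equiv.Perm ι) (x y : ι → ZMod 2) : act σ (x + y) = act σ x + act σ y := rfl

theorem act_neg (σ : Equiv.Perm ι) (x : ι → ZMod 2) : act σ (-x) = -act σ x := rfl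

theorem act_zero (σ : Equiv.Perm ι) : act σ (0 : ι → ZMod 2) = 0 := rfl

theorem act_mul (σ τ : Equiv.Perm ι) (x : ι → ZMod 2) : act (σ * τ) x = act σ (act τ x) := by
  funext i; simp [act, mul_inv_rev]

theorem act_one (x : ι → ZMod 2) : act 1 x = x := by
  funext i; simp [act]

theorem act_err (σ : Equiv.Perm ι) (e : Option ι) : act σ (err e) = err (e.map σ) := by
  cases e with
  | none => rfl
  | some i =>
    funext j
    simp only [act, err, Option.map_some, Pi.single_apply]
    congr 1
    rw [eq_iff_iff]
    constructor
    · intro h; rw [← h]; simp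
    · intro h; rw [h]; simp

theorem err_inj {e e' : Option ι} (h : (err e : ι → ZMod 2) = err e') : e = e' := by
  cases e with
  | none =>
    cases e' with
    | none => rfl
    | some j => exact absurd (congrFun h j) (by simp [err])
  | some i =>
    cases e' with
    | none => exact absurd (congrFun h i) (by simp [err])
    | some j =>
      have := congrFun h i
      simp only [err, Pi.single_apply] at this
      by_cases hij : i = j
      · rw [hij]
      · simp [hij] at this

theorem add_self (x : ι → ZMod 2) : x + x = 0 := by
  funext i; exact CharTwo.add_self_eq_zero (x i)

theorem neg_eq (x : ι → ZMod 2) : -x = x := by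
  funext i; exact CharTwo.neg_eq (x i)

/-- propelinear perfect code with rank defect `d` -/
structure IsPPC {ι : Type} [Fintype ι] [DecidableEq ι] (C : Set (ι → ZMod 2)) (d : ℕ) : Prop where
  zero : (0 : ι → ZMod 2) ∈ C
  perf : ∀ v, ∃! e : Option ι, v + err e ∈ C
  prop : ∃ P : (ι → ZMod 2) → Equiv.Perm ι, ∀ x ∈ C, ∀ y ∈ C,
    x + act (P x) y ∈ C ∧ P (x + act (P x) y) = P x * P y
  rank : Module.finrank (ZMod 2) (Submodule.span (ZMod 2) C) + d = Fintype.card ι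

/-- isometries -/
@[ext]
structure Iso (ι : Type) where
  v : ι → ZMod 2
  s : Equiv.Perm ι

instance : Mul (Iso ι) := ⟨fun x y => ⟨x.v + act x.s y.v, x.s * y.s⟩⟩
instance : One (Iso ι) := ⟨⟨0, 1⟩⟩
instance : Inv (Iso ι) := ⟨fun x => ⟨-act x.s⁻¹ x.v, x.s⁻¹⟩⟩

theorem mul_v (x y : Iso ι) : (x * y).v = x.v + act x.s y.v := rfl
theorem mul_s (x y : Iso ι) : (x * y).s = x.s * y.s := rfl
theorem one_v : (1 : Iso ι).v = 0 := rfl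
theorem one_s : (1 : Iso ι).s = 1 := rfl
theorem inv_v (x : Iso ι) : (x⁻¹).v = -act x.s⁻¹ x.v := rfl
theorem inv_s (x : Iso ι) : (x⁻¹).s = x.s⁻¹ := rfl

instance : Group (Iso ι) :=
  Group.ofLeftAxioms
    (by
      intro x y z
      ext1
      · simp only [mul_v, mul_s, act_add, act_mul, add_assoc]
      · simp only [mul_s, mul_assoc])
    (by
      intro x
      ext1
      · simp only [mul_v, one_v, one_s, act_one, zero_add]
      · simp only [mul_s, one_s, one_mul])
    (by
      intro x
      ext1
      · simp only [mul_v, inv_v, inv_s, one_v, neg_add_cancel]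
      · simp only [mul_s, inv_s, one_s, inv_mul_cancel])

instance : Finite (Iso ι) :=
  Finite.of_injective (fun x : Iso ι => (x.v, x.s)) (by
    intro x y h
    simp only [Prod.mk.injEq] at h
    exact Iso.ext h.1 h.2)

theorem sub_inj (H : Subgroup (Iso ι))
    (hd : ∀ x ∈ H, x ≠ 1 → ∀ e e' : Option ι, x.v ≠ err e + err e')
    {x y : Iso ι} (hx : x ∈ H) (hy : y ∈ H) {e e' : Option ι}
    (h : x.v + err e = y.v + err e') : x = y ∧ e = e' := by
  have hxy : x = y := by
    by_contra hne
    have h1 : x⁻¹ * y ≠ 1 := by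
      intro h'; exact hne (inv_mul_eq_one.mp h')
    refine hd _ (H.mul_mem (H.inv_mem hx) hy) h1 (e.map (⇑(x.s⁻¹))) (e'.map (⇑(x.s⁻¹))) ?_
    rw [← act_err, ← act_err, mul_v, inv_v, inv_s, ← act_neg, ← act_add, ← act_add]
    congr 1
    have h2 : y.v = x.v + err e - err e' := by rw [h]; abel
    rw [h2, sub_eq_add_neg, neg_eq (err e')]; abel
  refine ⟨hxy, ?_⟩
  subst hxy
  exact err_inj (add_left_cancel h)

theorem sub_perf (H : Subgroup (Iso ι))
    (hc : Nat.card H * (Fintype.card ι + 1) = 2 ^ Fintype.card ι)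
    (hd : ∀ x ∈ H, x ≠ 1 → ∀ e e' : Option ι, x.v ≠ err e + err e') (v : ι → ZMod 2) :
    ∃! e : Option ι, v + err e ∈ {c : ι → ZMod 2 | ∃ x ∈ H, x.v = c} := by
  classical
  have hinj : Function.Injective (fun p : H × Option ι => p.1.1.v + err p.2) := by
    rintro ⟨⟨x, hx⟩, e⟩ ⟨⟨y, hy⟩, e'⟩ h
    obtain ⟨h1, h2⟩ := sub_inj H hd hx hy h
    have h2' : e = e' := h2
    subst h1
    subst h2'
    rfl
  have : Fintype H := Fintype.ofFinite _
  have hbij : Function.Bijective (fun p : H × Option ι => p.1.1.v + err p.2) := by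
    rw [Fintype.bijective_iff_injective_and_card]
    refine ⟨hinj, ?_⟩
    rw [Nat.card_eq_fintype_card] at hc
    simp only [Fintype.card_prod, Fintype.card_option, Fintype.card_fun, ZMod.card]
    exact hc
  obtain ⟨⟨⟨x, hx⟩, e⟩, h⟩ := hbij.2 v
  simp only at h
  refine ⟨e, ⟨x, hx, ?_⟩, ?_⟩
  · rw [← h, add_assoc, add_self, add_zero]
  · rintro e' ⟨y, hy, h'⟩
    refine (sub_inj H hd hx hy (e := e) (e' := e') ?_).2.symm
    rw [h, h', add_assoc, add_self, add_zero]

theorem sub_prop (H : Subgroup (Iso ι))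
    (hd : ∀ x ∈ H, x ≠ 1 → ∀ e e' : Option ι, x.v ≠ err e + err e') :
    ∃ P : (ι → ZMod 2) → Equiv.Perm ι, (∀ x ∈ H, P x.v = x.s) ∧
      ∀ x ∈ {c : ι → ZMod 2 | ∃ x ∈ H, x.v = c}, ∀ y ∈ {c : ι → ZMod 2 | ∃ x ∈ H, x.v = c},
        x + act (P x) y ∈ {c : ι → ZMod 2 | ∃ x ∈ H, x.v = c} ∧
          P (x + act (P x) y) = P x * P y := by
  classical
  let P : (ι → ZMod 2) → Equiv.Perm ι := fun c =>
    if h : ∃ x ∈ H, x.v = c then h.choose.s else 1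
  have hP : ∀ x ∈ H, P x.v = x.s := by
    intro x hx
    have h : ∃ y ∈ H, y.v = x.v := ⟨x, hx, rfl⟩
    have h2 := h.choose_spec
    have : h.choose = x := (sub_inj H hd h2.1 hx (e := none) (e' := none) (by rw [h2.2])).1
    simp only [P, dif_pos h, this]
  refine ⟨P, hP, ?_⟩
  rintro _ ⟨x, hx, rfl⟩ _ ⟨y, hy, rfl⟩
  rw [hP x hx, hP y hy, ← mul_v]
  exact ⟨⟨x * y, H.mul_mem hx hy, rfl⟩, hP _ (H.mul_mem hx hy)⟩

theorem of_subgroup (H : Subgroup (Iso ι)) (d : ℕ)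
    (hc : Nat.card H * (Fintype.card ι + 1) = 2 ^ Fintype.card ι)
    (hd : ∀ x ∈ H, x ≠ 1 → ∀ e e' : Option ι, x.v ≠ err e + err e')
    (hr : Module.finrank (ZMod 2) (Submodule.span (ZMod 2) {c | ∃ x ∈ H, x.v = c}) + d
      = Fintype.card ι) :
    IsPPC {c : ι → ZMod 2 | ∃ x ∈ H, x.v = c} d := by
  obtain ⟨P, -, hP⟩ := sub_prop H hd
  exact ⟨⟨1, H.one_mem, rfl⟩, sub_perf H hc hd, ⟨P, hP⟩, hr⟩

end gen

theorem span_preimage {V V' : Type} [AddCommGroup V] [Module (ZMod 2) V]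
    [AddCommGroup V'] [Module (ZMod 2) V'] (Φ : V →ₗ[ZMod 2] V') (hΦ : Function.Surjective Φ)
    (S : Set V') (h0 : (0 : V') ∈ S) :
    Submodule.span (ZMod 2) (Φ ⁻¹' S) = (Submodule.span (ZMod 2) S).comap Φ := by
  have h1 : (Submodule.span (ZMod 2) (Φ ⁻¹' S)).map Φ = Submodule.span (ZMod 2) S := by
    rw [Submodule.map_span, Set.image_preimage_eq _ hΦ]
  rw [← h1, Submodule.comap_map_eq_self]
  intro x hx
  apply Submodule.subset_span
  rw [LinearMap.mem_ker] at hx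
  simpa [hx] using h0

theorem finrank_comap {V V' : Type} [AddCommGroup V] [Module (ZMod 2) V]
    [AddCommGroup V'] [Module (ZMod 2) V'] [FiniteDimensional (ZMod 2) V]
    [FiniteDimensional (ZMod 2) V'] (Φ : V →ₗ[ZMod 2] V') (hΦ : Function.Surjective Φ)
    (N : Submodule (ZMod 2) V') :
    Module.finrank (ZMod 2) (N.comap Φ) + Module.finrank (ZMod 2) V' =
      Module.finrank (ZMod 2) V + Module.finrank (ZMod 2) N := by
  have h1 := LinearMap.finrank_range_add_finrank_ker (N.mkQ ∘ₗ Φ)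
  have h2 : LinearMap.range (N.mkQ ∘ₗ Φ) = ⊤ := by
    rw [LinearMap.range_eq_top]
    exact N.mkQ_surjective.comp hΦ
  have h3 : LinearMap.ker (N.mkQ ∘ₗ Φ) = N.comap Φ := by
    rw [LinearMap.ker_comp, Submodule.ker_mkQ]
  rw [h2, h3, finrank_top] at h1
  have h4 := N.finrank_quotient_add_finrank
  omega

theorem span_prod_zero {V V' : Type} [AddCommGroup V] [Module (ZMod 2) V]
    [AddCommGroup V'] [Module (ZMod 2) V'] (S : Set V) (T : Set V') (hS : 0 ∈ S) (hT : 0 ∈ T) :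
    Submodule.span (ZMod 2) (S ×ˢ T) =
      (Submodule.span (ZMod 2) S).prod (Submodule.span (ZMod 2) T) := by
  apply le_antisymm
  · exact Submodule.span_prod_le S T
  · rintro ⟨a, b⟩ ⟨ha, hb⟩
    have h1 : ((a, 0) : V × V') ∈ Submodule.span (ZMod 2) (S ×ˢ T) := by
      have : (Submodule.span (ZMod 2) S).map (LinearMap.inl (ZMod 2) V V') ≤
          Submodule.span (ZMod 2) (S ×ˢ T) := by
        rw [Submodule.map_span]
        apply Submodule.span_mono
        rintro _ ⟨x, hx, rfl⟩
        exact ⟨hx, hT⟩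
      exact this ⟨a, ha, rfl⟩
    have h2 : ((0, b) : V × V') ∈ Submodule.span (ZMod 2) (S ×ˢ T) := by
      have : (Submodule.span (ZMod 2) T).map (LinearMap.inr (ZMod 2) V V') ≤
          Submodule.span (ZMod 2) (S ×ˢ T) := by
        rw [Submodule.map_span]
        apply Submodule.span_mono
        rintro _ ⟨x, hx, rfl⟩
        exact ⟨hS, hx⟩
      exact this ⟨b, hb, rfl⟩
    have := add_mem h1 h2
    simpa using this

theorem finrank_prod' {V V' : Type} [AddCommGroup V] [Module (ZMod 2) V]
    [AddCommGroup V'] [Module (ZMod 2) V'] [FiniteDimensional (ZMod 2) V]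
    [FiniteDimensional (ZMod 2) V'] (A : Submodule (ZMod 2) V) (B : Submodule (ZMod 2) V') :
    Module.finrank (ZMod 2) (A.prod B) = Module.finrank (ZMod 2) A + Module.finrank (ZMod 2) B := by
  rw [← Module.finrank_prod]
  exact LinearEquiv.finrank_eq
    { toFun := fun x => (⟨x.1.1, x.2.1⟩, ⟨x.1.2, x.2.2⟩)
      invFun := fun x => ⟨(x.1.1, x.2.1), ⟨x.1.2, x.2.2⟩⟩
      map_add' := fun _ _ => rfl
      map_smul' := fun _ _ => rfl
      left_inv := fun _ => rfl
      right_inv := fun _ => rfl }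

theorem existsUnique_of_bij {A B E : Type} (g : E → A × B) (hg : Function.Bijective g)
    (p : A → Prop) (q : A → B → Prop) (hp : ∃! a, p a) (hq : ∀ a, p a → ∃! b, q a b) :
    ∃! e, p (g e).1 ∧ q (g e).1 (g e).2 := by
  obtain ⟨a, ha, ha'⟩ := hp
  obtain ⟨b, hb, hb'⟩ := hq a ha
  obtain ⟨e, he⟩ := hg.2 (a, b)
  refine ⟨e, ?_, ?_⟩
  · simp only [he]; exact ⟨ha, hb⟩
  · rintro e' ⟨h1, h2⟩
    apply hg.1
    rw [he]
    have h3 := ha' _ h1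
    rw [h3] at h2
    exact Prod.ext h3 (hb' _ h2)

section moll
variable {t m : Type} [Fintype t] [DecidableEq t] [Fintype m] [DecidableEq m]

/-- Mollard parity map -/
def mPhi (t m : Type) [Fintype t] [Fintype m] :
    ((t × m ⊕ (t ⊕ m)) → ZMod 2) →ₗ[ZMod 2] (t → ZMod 2) × (m → ZMod 2) where
  toFun w := (fun i => w (Sum.inr (Sum.inl i)) + ∑ j, w (Sum.inl (i, j)),
    fun j => w (Sum.inr (Sum.inr j)) + ∑ i, w (Sum.inl (i, j)))
  map_add' x y := by
    ext i
    · simp only [Pi.add_apply, Finset.sum_add_distrib, Prod.fst_add]; ring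
    · simp only [Pi.add_apply, Finset.sum_add_distrib, Prod.snd_add]; ring
  map_smul' c x := by
    ext i
    · simp [Finset.mul_sum, mul_add]
    · simp [Finset.mul_sum, mul_add]

theorem mPhi_surj : Function.Surjective (mPhi t m) := by
  rintro ⟨y, z⟩
  refine ⟨Sum.elim 0 (Sum.elim y z), ?_⟩
  ext i <;> simp [mPhi]

/-- error map -/
def mG {t m : Type} : Option (t × m ⊕ (t ⊕ m)) → Option t × Option m
  | none => (none, none)
  | some (Sum.inl (i, j)) => (some i, some j)
  | some (Sum.inr (Sum.inl i)) => (some i, none)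
  | some (Sum.inr (Sum.inr j)) => (none, some j)

theorem mG_bij : Function.Bijective (mG : Option (t × m ⊕ (t ⊕ m)) → Option t × Option m) := by
  constructor
  · rintro (_ | ⟨i, j⟩ | i | j) (_ | ⟨i', j'⟩ | i' | j') h <;> simp_all [mG]
  · rintro ⟨_ | i, _ | j⟩
    · exact ⟨none, rfl⟩
    · exact ⟨some (Sum.inr (Sum.inr j)), rfl⟩
    · exact ⟨some (Sum.inr (Sum.inl i)), rfl⟩
    · exact ⟨some (Sum.inl (i, j)), rfl⟩

theorem mPhi_err (e : Option (t × m ⊕ (t ⊕ m))) :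
    mPhi t m (err e) = (err (mG e).1, err (mG e).2) := by
  rcases e with _ | ⟨i, j⟩ | i | j
  · exact map_zero _
  · ext k
    · by_cases h : k = i
      · subst h; simp [mPhi, mG, err, Pi.single_apply, Finset.filter_eq']
      · simp [mPhi, mG, err, Pi.single_apply, h]
    · by_cases h : k = j
      · subst h; simp [mPhi, mG, err, Pi.single_apply, Finset.filter_eq']
      · simp [mPhi, mG, err, Pi.single_apply, h]
  · ext k <;> simp [mPhi, mG, err, Pi.single_apply]
  · ext k <;> simp [mPhi, mG, err, Pi.single_apply]

/-- combined permutation -/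
def mP (σ : Equiv.Perm t) (τ : Equiv.Perm m) : Equiv.Perm (t × m ⊕ (t ⊕ m)) :=
  Equiv.sumCongr (Equiv.prodCongr σ τ) (Equiv.sumCongr σ τ)

theorem mP_mul (σ σ' : Equiv.Perm t) (τ τ' : Equiv.Perm m) :
    mP (σ * σ') (τ * τ') = mP σ τ * mP σ' τ' := by
  ext x
  rcases x with ⟨i, j⟩ | i | j <;> rfl

theorem mPhi_act (σ : Equiv.Perm t) (τ : Equiv.Perm m) (w : (t × m ⊕ (t ⊕ m)) → ZMod 2) :
    mPhi t m (act (mP σ τ) w) = (act σ (mPhi t m w).1, act τ (mPhi t m w).2) := by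
  ext k
  · change w (Sum.inr (Sum.inl (σ⁻¹ k))) + ∑ j, w (Sum.inl (σ⁻¹ k, τ⁻¹ j)) =
      w (Sum.inr (Sum.inl (σ⁻¹ k))) + ∑ j, w (Sum.inl (σ⁻¹ k, j))
    rw [Equiv.sum_comp (τ⁻¹) (fun j => w (Sum.inl (σ⁻¹ k, j)))]
  · change w (Sum.inr (Sum.inr (τ⁻¹ k))) + ∑ i, w (Sum.inl (σ⁻¹ i, τ⁻¹ k)) =
      w (Sum.inr (Sum.inr (τ⁻¹ k))) + ∑ i, w (Sum.inl (i, τ⁻¹ k))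
    rw [Equiv.sum_comp (σ⁻¹) (fun i => w (Sum.inl (i, τ⁻¹ k)))]

theorem mollard {C : Set (t → ZMod 2)} {D : Set (m → ZMod 2)} {d e : ℕ}
    (hC : IsPPC C d) (hD : IsPPC D e) : IsPPC (mPhi t m ⁻¹' (C ×ˢ D)) (d + e) := by
  refine ⟨?_, ?_, ?_, ?_⟩
  · rw [Set.mem_preimage, map_zero]
    exact ⟨hC.zero, hD.zero⟩
  · intro v
    have := existsUnique_of_bij (mG : Option (t × m ⊕ (t ⊕ m)) → Option t × Option m) mG_bij
      (fun a => (mPhi t m v).1 + err a ∈ C) (fun _ b => (mPhi t m v).2 + err b ∈ D)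
      (hC.perf _) (fun _ _ => hD.perf _)
    convert this using 2 with e
    rw [Set.mem_preimage, map_add, mPhi_err]
    rfl
  · obtain ⟨P, hP⟩ := hC.prop
    obtain ⟨Q, hQ⟩ := hD.prop
    refine ⟨fun w => mP (P (mPhi t m w).1) (Q (mPhi t m w).2), ?_⟩
    intro x hx y hy
    have h1 := hP _ hx.1 _ hy.1
    have h2 := hQ _ hx.2 _ hy.2
    have h3 : mPhi t m (x + act (mP (P (mPhi t m x).1) (Q (mPhi t m x).2)) y) =
        ((mPhi t m x).1 + act (P (mPhi t m x).1) (mPhi t m y).1,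
          (mPhi t m x).2 + act (Q (mPhi t m x).2) (mPhi t m y).2) := by
      rw [map_add, mPhi_act]; rfl
    constructor
    · rw [Set.mem_preimage, h3]
      exact ⟨h1.1, h2.1⟩
    · beta_reduce
      rw [h3, ← mP_mul, ← h1.2, ← h2.2]
  · have h0 : (0 : (t → ZMod 2) × (m → ZMod 2)) ∈ C ×ˢ D := ⟨hC.zero, hD.zero⟩
    rw [span_preimage _ mPhi_surj _ h0, span_prod_zero _ _ hC.zero hD.zero]
    have h := finrank_comap (mPhi t m) mPhi_surj
      ((Submodule.span (ZMod 2) C).prod (Submodule.span (ZMod 2) D))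
    rw [finrank_prod'] at h
    have h1 := hC.rank
    have h2 := hD.rank
    simp only [Module.finrank_prod, Module.finrank_fintype_fun_eq_card] at h
    omega

end moll

/-- existence of a propelinear perfect code of length `2^m-1` and defect `d` -/
def Ex (m d : ℕ) : Prop :=
  ∃ (ι : Type) (_ : Fintype ι) (_ : DecidableEq ι) (C : Set (ι → ZMod 2)),
    Fintype.card ι + 1 = 2 ^ m ∧ IsPPC C d

theorem Ex.add {a b d e : ℕ} (h : Ex a d) (h' : Ex b e) : Ex (a + b) (d + e) := by
  obtain ⟨t, _, _, C, hc, hC⟩ := h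
  obtain ⟨m, _, _, D, hd, hD⟩ := h'
  refine ⟨t × m ⊕ (t ⊕ m), inferInstance, inferInstance, _, ?_, mollard hC hD⟩
  simp only [Fintype.card_sum, Fintype.card_prod]
  rw [pow_add, ← hc, ← hd]; ring

theorem Ex.base : Ex 1 1 := by
  refine ⟨Unit, inferInstance, inferInstance, {0}, by simp, ⟨rfl, ?_, ?_, ?_⟩⟩
  · simp only [Set.mem_singleton_iff]
    unfold ExistsUnique
    decide
  · refine ⟨fun _ => 1, ?_⟩
    rintro _ rfl _ rfl
    simp [act_zero]
  · simp

section vas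
variable {t : Type} [Fintype t] [DecidableEq t]

theorem zsel (f : ZMod 2 → ZMod 2) (c : ZMod 2) : f c = f 0 + c * (f 0 + f 1) := by
  revert f c; decide

theorem zflip (f : ZMod 2 → ZMod 2) (c : ZMod 2) : f (0 + c) + f (1 + c) = f 0 + f 1 := by
  revert f c; decide

theorem zadd (k c : ZMod 2) : k + c + c = k := by
  revert k c; decide

/-- Vasilev parity map -/
def vPhi (t : Type) [Fintype t] :
    ((ZMod 2 × t ⊕ Unit) → ZMod 2) →ₗ[ZMod 2] (t → ZMod 2) × ZMod 2 where
  toFun w := (fun i => w (Sum.inl (0, i)) + w (Sum.inl (1, i)),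
    w (Sum.inr ()) + ∑ i, w (Sum.inl (0, i)))
  map_add' x y := by
    ext
    · simp only [Pi.add_apply, Prod.fst_add]; ring
    · simp only [Pi.add_apply, Finset.sum_add_distrib, Prod.snd_add]; ring
  map_smul' c x := by
    ext
    · simp [mul_add]
    · simp [Finset.mul_sum, mul_add]

theorem vPhi_surj : Function.Surjective (vPhi t) := by
  rintro ⟨y, z⟩
  refine ⟨Sum.elim (fun p => if p.1 = 0 then 0 else y p.2) (fun _ => z), ?_⟩
  ext <;> simp [vPhi]

/-- error map -/
def vG {t : Type} : Option (ZMod 2 × t ⊕ Unit) → Option t × Option Unit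
  | none => (none, none)
  | some (Sum.inl (k, i)) => (some i, if k = 0 then some () else none)
  | some (Sum.inr _) => (none, some ())

theorem zcases (k : ZMod 2) : k = 0 ∨ k = 1 := by revert k; decide

theorem vG_bij : Function.Bijective (vG : Option (ZMod 2 × t ⊕ Unit) → Option t × Option Unit) := by
  constructor
  · rintro (_ | ⟨k, i⟩ | i) (_ | ⟨k', i'⟩ | i') h <;> try simp_all [vG]
    rcases zcases k with rfl | rfl <;> rcases zcases k' with rfl | rfl <;> simp_all
  · rintro ⟨_ | i, _ | j⟩
    · exact ⟨none, rfl⟩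
    · exact ⟨some (Sum.inr ()), rfl⟩
    · exact ⟨some (Sum.inl (1, i)), rfl⟩
    · exact ⟨some (Sum.inl (0, i)), rfl⟩

/-- bit of an optional unit -/
def berr : Option Unit → ZMod 2
  | none => 0
  | some _ => 1

theorem berr_ex (c l : ZMod 2) : ∃! b : Option Unit, c + berr b = l := by
  unfold ExistsUnique; revert c l; decide

theorem vPhi_err (e : Option (ZMod 2 × t ⊕ Unit)) :
    vPhi t (err e) = (err (vG e).1, berr (vG e).2) := by
  rcases e with _ | ⟨k, i⟩ | u
  · exact map_zero _
  · rcases zcases k with rfl | rfl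
    · ext
      · simp [vPhi, vG, err, Pi.single_apply]
      · simp [vPhi, vG, err, berr, Pi.single_apply]
    · ext
      · simp [vPhi, vG, err, Pi.single_apply]
      · simp [vPhi, vG, err, berr, Pi.single_apply]
  · ext
    · simp [vPhi, vG, err]
    · simp [vPhi, vG, err, berr]

/-- lifted permutation with swaps -/
def vQ (σ : Equiv.Perm t) (s : t → ZMod 2) : Equiv.Perm (ZMod 2 × t ⊕ Unit) :=
  Equiv.sumCongr
    { toFun := fun p => (p.1 + s (σ p.2), σ p.2)
      invFun := fun p => (p.1 + s p.2, σ⁻¹ p.2)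
      left_inv := fun p => by simp [zadd]
      right_inv := fun p => by simp [zadd] } (Equiv.refl Unit)

theorem vQ_mul (σ σ' : Equiv.Perm t) (s s' : t → ZMod 2) :
    vQ (σ * σ') (s + act σ s') = vQ σ s * vQ σ' s' := by
  refine Equiv.ext ?_
  rintro (⟨k, i⟩ | u)
  · change Sum.inl (k + (s (σ (σ' i)) + s' (σ⁻¹ (σ (σ' i)))), σ (σ' i)) =
      (Sum.inl (k + s' (σ' i) + s (σ (σ' i)), σ (σ' i)) : ZMod 2 × t ⊕ Unit)
    congr 2
    have : σ⁻¹ (σ (σ' i)) = σ' i := by simp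
    rw [this]; ring
  · rfl

theorem vPhi_act (σ : Equiv.Perm t) (s : t → ZMod 2) (w : (ZMod 2 × t ⊕ Unit) → ZMod 2) :
    vPhi t (act (vQ σ s) w) = (act σ (vPhi t w).1,
      (vPhi t w).2 + ∑ i, s i * act σ (vPhi t w).1 i) := by
  ext i
  · exact zflip (fun k => w (Sum.inl (k, σ⁻¹ i))) (s i)
  · change w (Sum.inr ()) + ∑ i, w (Sum.inl (0 + s i, σ⁻¹ i)) =
      w (Sum.inr ()) + ∑ i, w (Sum.inl (0, i)) +
        ∑ i, s i * (w (Sum.inl (0, σ⁻¹ i)) + w (Sum.inl (1, σ⁻¹ i)))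
    rw [add_assoc, ← Equiv.sum_comp (σ⁻¹) (fun i => w (Sum.inl (0, i))), ← Finset.sum_add_distrib]
    congr 1
    refine Finset.sum_congr rfl fun i _ => ?_
    rw [zero_add]
    exact zsel (fun k => w (Sum.inl (k, σ⁻¹ i))) (s i)

/-- swap vector -/
def vS (a b : t) (y : t → ZMod 2) : t → ZMod 2 := Pi.single a (y b) + Pi.single b (y a)

theorem vS_sum (a b : t) (y z : t → ZMod 2) : ∑ i, vS a b y i * z i = y b * z a + y a * z b := by
  simp [vS, add_mul, Finset.sum_add_distrib, Pi.single_apply]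

theorem vS_add (a b : t) (y z : t → ZMod 2) : vS a b (y + z) = vS a b y + vS a b z := by
  simp only [vS, Pi.add_apply, Pi.single_add]; abel

theorem act_single (σ : Equiv.Perm t) (i : t) (c : ZMod 2) :
    act σ (Pi.single i c) = Pi.single (σ i) c := by
  funext j
  simp only [act, Pi.single_apply]
  congr 1
  rw [eq_iff_iff]
  constructor
  · intro h; rw [← h]; simp
  · intro h; rw [h]; simp

theorem vS_act (a b : t) (σ : Equiv.Perm t) (h : (σ a = a ∧ σ b = b) ∨ (σ a = b ∧ σ b = a))
    (y : t → ZMod 2) : vS a b (act σ y) = act σ (vS a b y) := by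
  unfold vS
  rw [act_add, act_single, act_single]
  rcases h with ⟨h1, h2⟩ | ⟨h1, h2⟩
  · have h3 : σ⁻¹ a = a := by rw [Equiv.Perm.inv_eq_iff_eq, h1]
    have h4 : σ⁻¹ b = b := by rw [Equiv.Perm.inv_eq_iff_eq, h2]
    simp only [act, h1, h2, h3, h4]
  · have h3 : σ⁻¹ a = b := by rw [Equiv.Perm.inv_eq_iff_eq, h2]
    have h4 : σ⁻¹ b = a := by rw [Equiv.Perm.inv_eq_iff_eq, h1]
    simp only [act, h1, h2, h3, h4]
    exact add_comm _ _

theorem lam_act (a b : t) (σ : Equiv.Perm t) (h : (σ a = a ∧ σ b = b) ∨ (σ a = b ∧ σ b = a))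
    (y : t → ZMod 2) : act σ y a * act σ y b = y a * y b := by
  rcases h with ⟨h1, h2⟩ | ⟨h1, h2⟩
  · have h3 : σ⁻¹ a = a := by rw [Equiv.Perm.inv_eq_iff_eq, h1]
    have h4 : σ⁻¹ b = b := by rw [Equiv.Perm.inv_eq_iff_eq, h2]
    simp only [act, h3, h4]
  · have h3 : σ⁻¹ a = b := by rw [Equiv.Perm.inv_eq_iff_eq, h2]
    have h4 : σ⁻¹ b = a := by rw [Equiv.Perm.inv_eq_iff_eq, h1]
    simp only [act, h3, h4]
    exact mul_comm _ _

theorem vasil {D : Set (t → ZMod 2)} (a b : t)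
    (h0 : (0 : t → ZMod 2) ∈ D) (hperf : ∀ v, ∃! e : Option t, v + err e ∈ D)
    (P : (t → ZMod 2) → Equiv.Perm t) (hP : ∀ x ∈ D, ∀ y ∈ D,
    x + act (P x) y ∈ D ∧ P (x + act (P x) y) = P x * P y)
    (hab : ∀ x ∈ D, (P x a = a ∧ P x b = b) ∨ (P x a = b ∧ P x b = a))
    (hs : Submodule.span (ZMod 2) {p : (t → ZMod 2) × ZMod 2 | p.1 ∈ D ∧ p.2 = p.1 a * p.1 b} = ⊤) :
    IsPPC (vPhi t ⁻¹' {p | p.1 ∈ D ∧ p.2 = p.1 a * p.1 b}) 0 := by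
  have h00 : (0 : (t → ZMod 2) × ZMod 2) ∈
      {p : (t → ZMod 2) × ZMod 2 | p.1 ∈ D ∧ p.2 = p.1 a * p.1 b} := ⟨h0, by simp⟩
  refine ⟨?_, ?_, ?_, ?_⟩
  · rw [Set.mem_preimage, map_zero]
    exact h00
  · intro v
    have := existsUnique_of_bij (vG : Option (ZMod 2 × t ⊕ Unit) → Option t × Option Unit) vG_bij
      (fun e => (vPhi t v).1 + err e ∈ D)
      (fun e c => (vPhi t v).2 + berr c =
        ((vPhi t v).1 + err e) a * ((vPhi t v).1 + err e) b)
      (hperf _) (fun _ _ => berr_ex _ _)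
    convert this using 2 with e
    rw [Set.mem_preimage, map_add, vPhi_err]
    rfl
  · refine ⟨fun w => vQ (P (vPhi t w).1) (vS a b (vPhi t w).1), ?_⟩
    rintro x ⟨hx, hx'⟩ y ⟨hy, hy'⟩
    have h1 := hP _ hx _ hy
    have h2 := hab _ hx
    have h3 : vPhi t (x + act (vQ (P (vPhi t x).1) (vS a b (vPhi t x).1)) y) =
        ((vPhi t x).1 + act (P (vPhi t x).1) (vPhi t y).1,
          (vPhi t x).2 + ((vPhi t y).2 + ((vPhi t x).1 b * act (P (vPhi t x).1) (vPhi t y).1 a +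
            (vPhi t x).1 a * act (P (vPhi t x).1) (vPhi t y).1 b))) := by
      rw [map_add, vPhi_act, vS_sum]; rfl
    constructor
    · rw [Set.mem_preimage, h3]
      refine ⟨h1.1, ?_⟩
      simp only [Pi.add_apply]
      rw [hx', hy', ← lam_act a b _ h2 (vPhi t y).1]
      ring
    · beta_reduce
      rw [h3, ← vQ_mul, ← h1.2, vS_add, vS_act a b _ h2]
  · rw [span_preimage _ vPhi_surj _ h00, hs, Submodule.comap_top, finrank_top,
      Module.finrank_fintype_fun_eq_card, add_zero]

end vas

section shadow

/-- word of a number -/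
def phi (n : ℕ) : Fin 15 → ZMod 2 := fun i => if n.testBit i then 1 else 0

theorem phi_xor (a b : ℕ) : phi (a ^^^ b) = phi a + phi b := by
  funext i
  simp only [phi, Nat.testBit_xor, Pi.add_apply]
  cases a.testBit i <;> cases b.testBit i <;> decide

theorem phi_zero : phi 0 = 0 := by
  funext i; simp [phi]

theorem phi_inj {a b : ℕ} (ha : a < 32768) (hb : b < 32768) (h : phi a = phi b) : a = b := by
  apply Nat.eq_of_testBit_eq
  intro i
  by_cases hi : i < 15
  · have := congrFun h ⟨i, hi⟩
    simp only [phi] at this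
    revert this
    cases a.testBit i <;> cases b.testBit i <;> simp
  · have h1 : 32768 ≤ 2 ^ i := by
      calc 32768 = 2 ^ 15 := by norm_num
        _ ≤ 2 ^ i := Nat.pow_le_pow_right (by norm_num) (by omega)
    rw [Nat.testBit_lt_two_pow (by omega), Nat.testBit_lt_two_pow (by omega)]

/-- evaluation helper -/
def force {α : Type} (n : ℕ) (f : ℕ → α) : α := Nat.rec (f 0) (fun k _ => f (k + 1)) n

theorem force_eq {α : Type} (n : ℕ) (f : ℕ → α) : force n f = f n := by
  cases n <;> rfl

/-- permuted word -/
def permN : List ℕ → ℕ → ℕ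
  | [], _ => 0
  | s :: p, a => ((a % 2) <<< s) ^^^ force (a / 2) (fun k => permN p k)

theorem mod_testBit (a k : ℕ) : (a % 2).testBit k = (decide (k = 0) && a.testBit 0) := by
  cases k with
  | zero => simp [Nat.testBit_zero]
  | succ k =>
    rw [Nat.testBit_succ, Nat.div_eq_of_lt (Nat.mod_lt _ (by norm_num))]
    simp

theorem permN_not_mem (p : List ℕ) (a j : ℕ) (h : j ∉ p) : (permN p a).testBit j = false := by
  induction p generalizing a with
  | nil => simp [permN]
  | cons s p ih =>
    simp only [List.mem_cons, not_or] at h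
    rw [permN, force_eq, Nat.testBit_xor, ih _ h.2, Nat.testBit_shiftLeft, mod_testBit]
    by_cases h2 : s ≤ j
    · have : j - s ≠ 0 := by omega
      simp [this]
    · simp [h2]

theorem permN_get (p : List ℕ) (hp : p.Nodup) (a i : ℕ) (h : i < p.length) :
    (permN p a).testBit p[i] = a.testBit i := by
  induction p generalizing a i with
  | nil => simp at h
  | cons s p ih =>
    rw [List.nodup_cons] at hp
    rw [permN, force_eq, Nat.testBit_xor, Nat.testBit_shiftLeft, mod_testBit]
    cases i with
    | zero =>
      rw [List.getElem_cons_zero, permN_not_mem p _ _ hp.1]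
      simp
    | succ i =>
      simp only [List.length_cons] at h
      rw [List.getElem_cons_succ, ih hp.2 _ _ (by omega), Nat.testBit_succ]
      have hne : p[i] ≠ s := by
        intro h'
        exact hp.1 (h' ▸ List.getElem_mem _)
      by_cases h2 : s ≤ p[i]
      · have : p[i] - s ≠ 0 := by omega
        simp [this]
      · simp [h2]

/-- image list of a permutation -/
def plist (σ : Equiv.Perm (Fin 15)) : List ℕ := List.ofFn (fun i => ((σ i : Fin 15) : ℕ))

theorem plist_nodup (σ : Equiv.Perm (Fin 15)) : (plist σ).Nodup := by
  unfold plist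
  rw [List.nodup_ofFn]
  intro i j h
  exact σ.injective (Fin.ext h)

theorem plist_length (σ : Equiv.Perm (Fin 15)) : (plist σ).length = 15 := List.length_ofFn

theorem plist_get (σ : Equiv.Perm (Fin 15)) (i : ℕ) (h : i < (plist σ).length) (h' : i < 15) :
    (plist σ)[i] = ((σ ⟨i, h'⟩ : Fin 15) : ℕ) := List.getElem_ofFn _

theorem plist_getD (σ : Equiv.Perm (Fin 15)) (i : Fin 15) :
    (plist σ).getD i 0 = ((σ i : Fin 15) : ℕ) := by
  have h : (i : ℕ) < (plist σ).length := by rw [plist_length]; exact i.2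
  rw [List.getD_eq_getElem _ _ h]
  exact plist_get σ i h i.2

theorem phi_permN (σ : Equiv.Perm (Fin 15)) (a : ℕ) : phi (permN (plist σ) a) = act σ (phi a) := by
  funext j
  obtain ⟨i, rfl⟩ := σ.surjective j
  have h : (i : ℕ) < (plist σ).length := by rw [plist_length]; exact i.2
  have h1 := permN_get (plist σ) (plist_nodup σ) a i h
  have h2 : (plist σ)[(i : ℕ)] = ((σ i : Fin 15) : ℕ) := plist_get σ i h i.2
  rw [h2] at h1
  simp [phi, act, h1]

/-- shadow elements -/
abbrev Sh := ℕ × List ℕ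

/-- shadow action on words -/
def ap (g : Sh) (n : ℕ) : ℕ := g.1 ^^^ permN g.2 n

/-- shadow product -/
def shMul (a b : Sh) : Sh := (force b.1 (fun n => ap a n), b.2.map (fun k => a.2.getD k 0))

/-- shadow identity -/
def shOne : Sh := (0, List.range 15)

/-- `a` represents `x` -/
def Rep (a : Sh) (x : Iso (Fin 15)) : Prop := phi a.1 = x.v ∧ a.2 = plist x.s

theorem plist_inj {σ τ : Equiv.Perm (Fin 15)} (h : plist σ = plist τ) : σ = τ := by
  have h1 := List.ofFn_injective h
  ext i
  exact congrFun h1 i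

theorem Rep.unique {a : Sh} {x y : Iso (Fin 15)} (h : Rep a x) (h' : Rep a y) : x = y :=
  Iso.ext (h.1.symm.trans h'.1) (plist_inj (h.2.symm.trans h'.2))

theorem Rep.ap {a : Sh} {x : Iso (Fin 15)} (h : Rep a x) {n : ℕ} {y : Iso (Fin 15)}
    (hn : phi n = y.v) : phi (ap a n) = (x * y).v := by
  rw [PPC.ap, phi_xor, h.1, h.2, phi_permN, hn, mul_v]

theorem Rep.mul {a b : Sh} {x y : Iso (Fin 15)} (h : Rep a x) (h' : Rep b y) :
    Rep (shMul a b) (x * y) := by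
  refine ⟨?_, ?_⟩
  · rw [shMul, force_eq]
    exact h.ap h'.1
  · rw [shMul, mul_s]
    simp only [h'.2, h.2]
    nth_rewrite 2 [plist]
    rw [List.map_ofFn, plist]
    congr 1
    funext i
    exact plist_getD x.s (y.s i)

theorem Rep.one : Rep shOne 1 := by
  refine ⟨phi_zero, ?_⟩
  decide

/-- validity of a shadow -/
def valid (a : Sh) : Bool :=
  decide (a.2.length = 15) && (a.2.all (fun k => decide (k < 15)) && decide (a.2.Nodup))

theorem valid_rep {a : Sh} (h : valid a = true) : ∃ x, Rep a x := by
  simp only [valid, Bool.and_eq_true, decide_eq_true_eq, List.all_eq_true] at h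
  obtain ⟨h1, h2, h3⟩ := h
  let f : Fin 15 → Fin 15 := fun i => ⟨a.2[(i : ℕ)]'(by rw [h1]; exact i.2), h2 _ (List.getElem_mem _)⟩
  have hf : Function.Injective f := by
    intro i j hij
    have := congrArg Fin.val hij
    simp only [f] at this
    exact Fin.ext ((List.Nodup.getElem_inj_iff h3).mp this)
  refine ⟨⟨phi a.1, Equiv.ofBijective f (Finite.injective_iff_bijective.mp hf)⟩, rfl, ?_⟩
  apply List.ext_getElem
  · rw [plist_length, h1]
  · intro i h4 h5
    refine Eq.trans ?_ (plist_get _ i h5 (by omega)).symm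
    rfl

/-- normal forms -/
def nf : List Sh → ℕ → Sh
  | [], _ => shOne
  | g :: gs, m => if m % 2 = 1 then shMul g (nf gs (m / 2)) else nf gs (m / 2)

/-- words of normal forms -/
def wd : List Sh → ℕ → ℕ
  | [], _ => 0
  | g :: gs, m => if m % 2 = 1 then force (wd gs (m / 2)) (fun n => ap g n) else wd gs (m / 2)

/-- generated group -/
def HH (gs : List Sh) : Subgroup (Iso (Fin 15)) := Subgroup.closure {x | ∃ g ∈ gs, Rep g x}

theorem HH_mono (g : Sh) (gs : List Sh) : HH gs ≤ HH (g :: gs) := by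
  apply Subgroup.closure_mono
  rintro x ⟨h, hh, hx⟩
  exact ⟨h, List.mem_cons_of_mem _ hh, hx⟩

theorem HH_head {g : Sh} {gs : List Sh} {x : Iso (Fin 15)} (h : Rep g x) : x ∈ HH (g :: gs) :=
  Subgroup.subset_closure ⟨g, List.mem_cons_self, h⟩

theorem nf_mem (gs : List Sh) (hv : ∀ g ∈ gs, valid g = true) (m : ℕ) :
    ∃ x ∈ HH gs, Rep (nf gs m) x ∧ phi (wd gs m) = x.v := by
  induction gs generalizing m with
  | nil => exact ⟨1, Subgroup.one_mem _, Rep.one, phi_zero⟩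
  | cons g gs ih =>
    obtain ⟨x, hx, h1, h2⟩ := ih (fun g hg => hv g (List.mem_cons_of_mem _ hg)) (m / 2)
    by_cases hm : m % 2 = 1
    · obtain ⟨y, hy⟩ := valid_rep (hv g List.mem_cons_self)
      refine ⟨y * x, Subgroup.mul_mem _ (HH_head hy) (HH_mono _ _ hx), ?_, ?_⟩
      · rw [nf, if_pos hm]; exact hy.mul h1
      · rw [wd, if_pos hm, force_eq]; exact hy.ap h2
    · refine ⟨x, HH_mono _ _ hx, ?_, ?_⟩
      · rw [nf, if_neg hm]; exact h1
      · rw [wd, if_neg hm]; exact h2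

/-- conjugation certificates -/
def conjOK (g : Sh) (gs : List Sh) : List Sh → List ℕ → Bool
  | [], _ => true
  | _ :: _, [] => false
  | h :: hs, m :: ms => decide (shMul h g = shMul g (nf gs m)) && conjOK g gs hs ms

theorem conjOK_spec (g : Sh) (gs : List Sh) : ∀ (hs : List Sh) (ms : List ℕ),
    conjOK g gs hs ms = true → ∀ h ∈ hs, ∃ m, shMul h g = shMul g (nf gs m)
  | [], _ => by simp
  | _ :: _, [] => by simp [conjOK]
  | h :: hs, m :: ms => by
    intro hc
    simp only [conjOK, Bool.and_eq_true, decide_eq_true_eq] at hc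
    intro h' hh'
    rcases List.mem_cons.mp hh' with rfl | hh'
    · exact ⟨m, hc.1⟩
    · exact conjOK_spec g gs hs ms hc.2 h' hh'

/-- chain certificate -/
def certOK : List Sh → List (ℕ × List ℕ) → Bool
  | [], _ => true
  | _ :: _, [] => false
  | g :: gs, c :: cs => valid g && (decide (shMul g g = nf gs c.1) &&
      (conjOK g gs gs c.2 && certOK gs cs))

theorem certOK_valid : ∀ (gs : List Sh) (cs : List (ℕ × List ℕ)), certOK gs cs = true →
    ∀ g ∈ gs, valid g = true
  | [], _ => by simp
  | _ :: _, [] => by simp [certOK]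
  | g :: gs, c :: cs => by
    intro h
    simp only [certOK, Bool.and_eq_true] at h
    intro g' hg'
    rcases List.mem_cons.mp hg' with rfl | hg'
    · exact h.1
    · exact certOK_valid gs cs h.2.2.2 g' hg'

theorem step_mem {G : Type} [Group G] (S : Set G) (H : Subgroup G) (x : G)
    (hS : ∀ s ∈ S, s = x ∨ s ∈ H) (h2 : x * x ∈ H) (hN : ∀ y ∈ H, x⁻¹ * y * x ∈ H)
    {z : G} (hz : z ∈ Subgroup.closure S) : z ∈ H ∨ ∃ y ∈ H, z = x * y := by
  induction hz using Subgroup.closure_induction with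
  | mem s hs =>
    rcases hS s hs with rfl | h
    · exact Or.inr ⟨1, H.one_mem, (mul_one _).symm⟩
    · exact Or.inl h
  | one => exact Or.inl H.one_mem
  | mul a b _ _ ha hb =>
    rcases ha with ha | ⟨y, hy, rfl⟩
    · rcases hb with hb | ⟨y', hy', rfl⟩
      · exact Or.inl (H.mul_mem ha hb)
      · exact Or.inr ⟨(x⁻¹ * a * x) * y', H.mul_mem (hN a ha) hy', by group⟩
    · rcases hb with hb | ⟨y', hy', rfl⟩
      · exact Or.inr ⟨y * b, H.mul_mem hy hb, by group⟩
      · refine Or.inl ?_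
        have := H.mul_mem (H.mul_mem h2 (hN y hy)) hy'
        convert this using 1
        group
  | inv a _ ha =>
    rcases ha with ha | ⟨y, hy, rfl⟩
    · exact Or.inl (H.inv_mem ha)
    · refine Or.inr ⟨(x * x)⁻¹ * (x⁻¹ * (x * x * y⁻¹ * (x * x)⁻¹) * x), ?_, by group⟩
      exact H.mul_mem (H.inv_mem h2)
        (hN _ (H.mul_mem (H.mul_mem h2 (H.inv_mem hy)) (H.inv_mem h2)))

theorem HH_step {g : Sh} {gs : List Sh} {c : ℕ × List ℕ} {cs : List (ℕ × List ℕ)}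
    (h : certOK (g :: gs) (c :: cs) = true) {x : Iso (Fin 15)} (hx : Rep g x)
    {z : Iso (Fin 15)} (hz : z ∈ HH (g :: gs)) : z ∈ HH gs ∨ ∃ y ∈ HH gs, z = x * y := by
  simp only [certOK, Bool.and_eq_true, decide_eq_true_eq] at h
  have hv := certOK_valid gs cs h.2.2.2
  refine step_mem _ (HH gs) x ?_ ?_ ?_ hz
  · rintro s ⟨g', hg', hs⟩
    rcases List.mem_cons.mp hg' with rfl | hg'
    · exact Or.inl (hs.unique hx)
    · exact Or.inr (Subgroup.subset_closure ⟨g', hg', hs⟩)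
  · obtain ⟨y, hy, h1, -⟩ := nf_mem gs hv c.1
    have h2 := hx.mul hx
    rw [h.2.1] at h2
    rw [h2.unique h1]; exact hy
  · intro y hy
    have : HH gs ≤ (HH gs).comap (MulAut.conj x⁻¹).toMonoidHom := by
      unfold HH
      rw [Subgroup.closure_le]
      rintro s ⟨g', hg', hs⟩
      obtain ⟨m, hm⟩ := conjOK_spec g gs gs c.2 h.2.2.1 g' hg'
      obtain ⟨w, hw, h1, -⟩ := nf_mem gs hv m
      have h2 := hs.mul hx
      rw [hm] at h2
      have h3 : s * x = x * w := h2.unique (hx.mul h1)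
      change x⁻¹ * s * (x⁻¹)⁻¹ ∈ HH gs
      rw [inv_inv, mul_assoc, h3, inv_mul_cancel_left]
      exact hw
    have h5 := this hy
    change x⁻¹ * y * (x⁻¹)⁻¹ ∈ HH gs at h5
    rwa [inv_inv] at h5

/-- reachable words -/
def reach : List Sh → ℕ → List ℕ
  | [], _ => []
  | g :: l, n => reach l n ++ ap g n :: reach l (ap g n)

/-- search -/
def dfs (ok : ℕ → Bool) : List Sh → ℕ → Bool
  | [], _ => true
  | g :: l, n => dfs ok l n && force (ap g n) (fun k => ok k && dfs ok l k)

theorem dfs_spec (ok : ℕ → Bool) (l : List Sh) (n : ℕ) (h : dfs ok l n = true) :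
    ∀ m ∈ reach l n, ok m = true := by
  induction l generalizing n with
  | nil => simp [reach]
  | cons g l ih =>
    simp only [dfs, force_eq, Bool.and_eq_true] at h
    intro m hm
    simp only [reach, List.mem_append, List.mem_cons] at hm
    rcases hm with hm | rfl | hm
    · exact ih _ h.1 m hm
    · exact h.2.1
    · exact ih _ h.2.2 m hm

theorem reach_append (l : List Sh) (g : Sh) (n m : ℕ) : m ∈ reach (l ++ [g]) n ↔
    m ∈ reach l n ∨ m = ap g n ∨ ∃ k ∈ reach l n, m = ap g k := by
  induction l generalizing n with
  | nil => simp [reach]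
  | cons h l ih =>
    simp only [List.cons_append, reach, List.mem_append, List.mem_cons, ih]
    constructor
    · rintro ((h1 | h1 | ⟨k, h1, h2⟩) | h1 | h1 | h1 | ⟨k, h1, h2⟩)
      · exact Or.inl (Or.inl h1)
      · exact Or.inr (Or.inl h1)
      · exact Or.inr (Or.inr ⟨k, Or.inl h1, h2⟩)
      · exact Or.inl (Or.inr (Or.inl h1))
      · exact Or.inl (Or.inr (Or.inr h1))
      · exact Or.inr (Or.inr ⟨_, Or.inr (Or.inl rfl), h1⟩)
      · exact Or.inr (Or.inr ⟨k, Or.inr (Or.inr h1), h2⟩)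
    · rintro ((h1 | h1 | h1) | h1 | ⟨k, h1 | rfl | h1, h2⟩)
      · exact Or.inl (Or.inl h1)
      · exact Or.inr (Or.inl h1)
      · exact Or.inr (Or.inr (Or.inl h1))
      · exact Or.inl (Or.inr (Or.inl h1))
      · exact Or.inl (Or.inr (Or.inr ⟨k, h1, h2⟩))
      · exact Or.inr (Or.inr (Or.inr (Or.inl h2)))
      · exact Or.inr (Or.inr (Or.inr (Or.inr ⟨k, h1, h2⟩)))

theorem HH_words : ∀ (gs : List Sh) (cs : List (ℕ × List ℕ)), certOK gs cs = true →
    ∀ x ∈ HH gs, x = 1 ∨ ∃ n ∈ reach gs.reverse 0, phi n = x.v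
  | [], _ => by
    intro _ x hx
    left
    have : HH [] = ⊥ := by
      unfold HH
      rw [Subgroup.closure_eq_bot_iff]
      rintro y ⟨g, hg, -⟩
      simp at hg
    rw [this] at hx
    exact hx
  | _ :: _, [] => by simp [certOK]
  | g :: gs, c :: cs => by
    intro h z hz
    obtain ⟨x, hx⟩ := valid_rep (certOK_valid _ _ h g List.mem_cons_self)
    have h' : certOK gs cs = true := by
      simp only [certOK, Bool.and_eq_true] at h
      exact h.2.2.2
    have ih := HH_words gs cs h'
    rw [List.reverse_cons]
    simp only [reach_append]
    rcases HH_step h hx hz with h1 | ⟨y, hy, rfl⟩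
    · rcases ih z h1 with h2 | ⟨n, hn, h3⟩
      · exact Or.inl h2
      · exact Or.inr ⟨n, Or.inl hn, h3⟩
    · right
      rcases ih y hy with rfl | ⟨n, hn, h3⟩
      · exact ⟨_, Or.inr (Or.inl rfl), hx.ap (y := 1) phi_zero⟩
      · exact ⟨_, Or.inr (Or.inr ⟨n, hn, rfl⟩), hx.ap h3⟩

/-- weight at least three test -/
def chk (n : ℕ) : Bool :=
  Nat.ble n 32767 && !(Nat.beq ((n &&& (n - 1)) &&& ((n &&& (n - 1)) - 1)) 0)

/-- number of an error -/
def errN : Option (Fin 15) → ℕ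
  | none => 0
  | some i => 2 ^ (i : ℕ)

theorem phi_errN (e : Option (Fin 15)) : phi (errN e) = err e := by
  cases e with
  | none => exact phi_zero
  | some i =>
    funext j
    simp only [phi, errN, err, Nat.testBit_two_pow, Pi.single_apply]
    simp [Fin.ext_iff, eq_comm]

theorem errN_lt (e e' : Option (Fin 15)) : errN e ^^^ errN e' < 32768 := by
  revert e e'; decide +kernel

theorem chk_err (e e' : Option (Fin 15)) : chk (errN e ^^^ errN e') = false := by
  revert e e'; decide +kernel

theorem chk_ne {n : ℕ} (h : chk n = true) (e e' : Option (Fin 15)) : phi n ≠ err e + err e' := by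
  intro h1
  rw [← phi_errN, ← phi_errN, ← phi_xor] at h1
  have h2 : n < 32768 := by
    simp only [chk, Bool.and_eq_true] at h
    have := Nat.le_of_ble_eq_true h.1
    omega
  rw [phi_inj h2 (errN_lt e e') h1, chk_err] at h
  exact absurd h (by simp)

theorem HH_dist {gs : List Sh} {cs : List (ℕ × List ℕ)} (h : certOK gs cs = true)
    (hw : ∀ n ∈ reach gs.reverse 0, chk n = true) :
    ∀ x ∈ HH gs, x ≠ 1 → ∀ e e' : Option (Fin 15), x.v ≠ err e + err e' := by
  intro x hx hne e e'
  rcases HH_words gs cs h x hx with h1 | ⟨n, hn, h2⟩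
  · exact absurd h1 hne
  · rw [← h2]
    exact chk_ne (hw n hn) e e'

theorem HH_card : ∀ (gs : List Sh) (cs : List (ℕ × List ℕ)), certOK gs cs = true →
    (∀ n ∈ reach gs.reverse 0, chk n = true) → Nat.card (HH gs) = 2 ^ gs.length
  | [], _ => by
    intro _ _
    have : HH [] = ⊥ := by
      unfold HH
      rw [Subgroup.closure_eq_bot_iff]
      rintro y ⟨g, hg, -⟩
      simp at hg
    rw [this]; simp
  | _ :: _, [] => by simp [certOK]
  | g :: gs, c :: cs => by
    intro h hw
    obtain ⟨x, hx⟩ := valid_rep (certOK_valid _ _ h g List.mem_cons_self)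
    have h' : certOK gs cs = true := by
      simp only [certOK, Bool.and_eq_true] at h
      exact h.2.2.2
    rw [List.reverse_cons] at hw
    simp only [reach_append] at hw
    have ih := HH_card gs cs h' (fun n hn => hw n (Or.inl hn))
    have hxn : x ∉ HH gs := by
      intro hxH
      have key : ∃ n, chk n = true ∧ phi n = (x * x⁻¹).v := by
        rcases HH_words gs cs h' x⁻¹ (Subgroup.inv_mem _ hxH) with h1 | ⟨n, hn, h2⟩
        · refine ⟨ap g 0, hw _ (Or.inr (Or.inl rfl)), hx.ap ?_⟩
          rw [h1, phi_zero]; rfl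
        · exact ⟨ap g n, hw _ (Or.inr (Or.inr ⟨n, hn, rfl⟩)), hx.ap h2⟩
      obtain ⟨n, h1, h2⟩ := key
      apply chk_ne h1 none none
      rw [h2, mul_inv_cancel]
      simp [err, one_v]
    let f : Bool × HH gs → HH (g :: gs) := fun p =>
      if p.1 then ⟨x * p.2.1, Subgroup.mul_mem _ (HH_head hx) (HH_mono _ _ p.2.2)⟩
      else ⟨p.2.1, HH_mono _ _ p.2.2⟩
    have hf : Function.Bijective f := by
      constructor
      · rintro ⟨b, y, hy⟩ ⟨b', y', hy'⟩ hbb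
        cases b <;> cases b' <;> simp [f] at hbb ⊢
        · exact hbb
        · apply hxn
          have : x = y * y'⁻¹ := by rw [hbb]; group
          rw [this]
          exact Subgroup.mul_mem _ hy (Subgroup.inv_mem _ hy')
        · apply hxn
          have : x = y' * y⁻¹ := by rw [← hbb]; group
          rw [this]
          exact Subgroup.mul_mem _ hy' (Subgroup.inv_mem _ hy)
        · exact hbb
      · rintro ⟨z, hz⟩
        rcases HH_step h hx hz with h1 | ⟨y, hy, rfl⟩
        · exact ⟨(false, ⟨z, h1⟩), rfl⟩
        · exact ⟨(true, ⟨y, hy⟩), rfl⟩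
    rw [← Nat.card_eq_of_bijective f hf, Nat.card_prod, ih, List.length_cons, pow_succ]
    simp [mul_comm]

end shadow

section rank

theorem rank_lemma (d : ℕ) (u : Fin d → ℕ) (p : Fin d → Fin 15)
    (hp : ∀ a b, phi (u a) (p b) = if a = b then 1 else 0)
    (S : Submodule (ZMod 2) (Fin 15 → ZMod 2))
    (horth : ∀ x ∈ S, ∀ a, ∑ i, phi (u a) i * x i = 0)
    (hb : ∀ i, err (some i) + ∑ a, phi (u a) i • err (some (p a)) ∈ S) :
    Module.finrank (ZMod 2) S + d = 15 := by
  let L : (Fin 15 → ZMod 2) →ₗ[ZMod 2] (Fin d → ZMod 2) :=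
    { toFun := fun x a => ∑ i, phi (u a) i * x i
      map_add' := fun x y => by
        funext a; simp [mul_add, Finset.sum_add_distrib]
      map_smul' := fun c x => by
        funext a; simp only [Pi.smul_apply, smul_eq_mul, RingHom.id_apply, Finset.mul_sum]
        exact Finset.sum_congr rfl fun i _ => by ring }
  have hL : ∀ x a, L x a = ∑ i, phi (u a) i * x i := fun _ _ => rfl
  have hLe : ∀ b, L (err (some (p b))) = Pi.single b 1 := by
    intro b
    funext a
    rw [hL]
    simp only [err, Pi.single_apply, mul_ite, mul_one, mul_zero, Finset.sum_ite_eq',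
      Finset.mem_univ, if_true]
    rw [hp a b]
  have hsurj : Function.Surjective L := by
    intro c
    refine ⟨∑ b, c b • err (some (p b)), ?_⟩
    rw [map_sum]
    simp only [map_smul, hLe]
    funext a
    simp [Finset.sum_apply, Pi.single_apply]
  have hS : S = LinearMap.ker L := by
    apply le_antisymm
    · intro x hx
      rw [LinearMap.mem_ker]
      funext a
      exact horth x hx a
    · intro x hx
      rw [LinearMap.mem_ker] at hx
      have hx' : ∀ a, ∑ i, phi (u a) i * x i = 0 := fun a => congrFun hx a
      have h1 : x = ∑ i, x i • (err (some i) + ∑ a, phi (u a) i • err (some (p a))) := by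
        simp only [smul_add, Finset.sum_add_distrib]
        have h2 : ∑ i, x i • ∑ a, phi (u a) i • (err (some (p a)) : Fin 15 → ZMod 2) = 0 := by
          simp only [Finset.smul_sum]
          rw [Finset.sum_comm]
          apply Finset.sum_eq_zero
          intro a _
          simp only [smul_smul]
          rw [← Finset.sum_smul]
          have : ∑ i, x i * phi (u a) i = 0 := by
            rw [← hx' a]
            exact Finset.sum_congr rfl fun i _ => mul_comm _ _
          rw [this, zero_smul]
        rw [h2, add_zero]
        funext j
        simp [err, Finset.sum_apply, Pi.single_apply]
      rw [h1]
      exact Submodule.sum_mem _ fun i _ => Submodule.smul_mem _ _ (hb i)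
  have h1 := LinearMap.finrank_range_add_finrank_ker L
  rw [LinearMap.range_eq_top.mpr hsurj, finrank_top, ← hS] at h1
  simp only [Module.finrank_fintype_fun_eq_card, Fintype.card_fin] at h1
  omega

theorem maps_inv {S : Set (Fin 15 → ZMod 2)} (σ : Equiv.Perm (Fin 15))
    (h : ∀ u ∈ S, act σ u ∈ S) : ∀ u ∈ S, act σ⁻¹ u ∈ S := by
  have hpow : ∀ k : ℕ, ∀ u ∈ S, act (σ ^ k) u ∈ S := by
    intro k
    induction k with
    | zero => intro u hu; rw [pow_zero, act_one]; exact hu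
    | succ k ih =>
      intro u hu
      rw [pow_succ, act_mul]
      exact ih _ (h u hu)
  have h1 : σ⁻¹ = σ ^ (orderOf σ - 1) := by
    rw [inv_eq_iff_mul_eq_one, mul_pow_sub_one (orderOf_pos σ).ne', pow_orderOf_eq_one]
  rw [h1]
  exact hpow _

theorem dot_act (σ : Equiv.Perm (Fin 15)) (u y : Fin 15 → ZMod 2) :
    ∑ i, u i * act σ y i = ∑ i, act σ⁻¹ u i * y i := by
  rw [← Equiv.sum_comp σ]
  simp [act]

/-- the code -/
def CC (gs : List Sh) : Set (Fin 15 → ZMod 2) := {c | ∃ x ∈ HH gs, x.v = c}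

theorem orth {gs : List Sh} {Us : List ℕ}
    (h1 : ∀ g ∈ gs, ∀ u ∈ Us, ∑ i, phi u i * phi g.1 i = 0)
    (h2 : ∀ g ∈ gs, ∀ u ∈ Us, permN g.2 u ∈ Us) :
    ∀ x ∈ Submodule.span (ZMod 2) (CC gs), ∀ u ∈ Us, ∑ i, phi u i * x i = 0 := by
  have key : ∀ x ∈ HH gs, (∀ u ∈ phi '' {n | n ∈ Us}, ∑ i, u i * x.v i = 0) ∧
      (∀ u ∈ phi '' {n | n ∈ Us}, act x.s u ∈ phi '' {n | n ∈ Us}) := by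
    intro x hx
    unfold HH at hx
    induction hx using Subgroup.closure_induction with
    | mem x hx =>
      obtain ⟨g, hg, hr⟩ := hx
      constructor
      · rintro _ ⟨n, hn, rfl⟩
        rw [← hr.1]; exact h1 g hg n hn
      · rintro _ ⟨n, hn, rfl⟩
        refine ⟨permN g.2 n, h2 g hg n hn, ?_⟩
        rw [hr.2, phi_permN]
    | one =>
      refine ⟨fun u _ => by simp [one_v], fun u hu => ?_⟩
      rw [one_s, act_one]; exact hu
    | mul x y _ _ hx hy =>
      constructor
      · intro u hu
        rw [mul_v]
        simp only [Pi.add_apply, mul_add, Finset.sum_add_distrib]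
        rw [hx.1 u hu, dot_act, hy.1 _ (maps_inv _ hx.2 u hu), add_zero]
      · intro u hu
        rw [mul_s, act_mul]
        exact hx.2 _ (hy.2 u hu)
    | inv x _ hx =>
      constructor
      · intro u hu
        rw [inv_v, neg_eq, dot_act, inv_inv]
        exact hx.1 _ (hx.2 u hu)
      · exact maps_inv _ hx.2
  intro x hx u hu
  induction hx using Submodule.span_induction with
  | mem x hx =>
    obtain ⟨y, hy, rfl⟩ := hx
    exact (key y hy).1 _ ⟨u, hu, rfl⟩
  | zero => simp
  | add x y _ _ hx hy => simp [mul_add, Finset.sum_add_distrib, hx, hy]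
  | smul c x _ hx =>
    have : ∑ i, phi u i * (c • x) i = c * ∑ i, phi u i * x i := by
      rw [Finset.mul_sum]
      exact Finset.sum_congr rfl fun i _ => by simp only [Pi.smul_apply, smul_eq_mul]; ring
    rw [this, hx, mul_zero]

/-- sum of code words -/
def wsum (gs : List Sh) : List ℕ → ℕ
  | [] => 0
  | m :: ms => wd gs m ^^^ wsum gs ms

theorem wd_mem {gs : List Sh} (hv : ∀ g ∈ gs, valid g = true) (m : ℕ) : phi (wd gs m) ∈ CC gs := by
  obtain ⟨x, hx, -, h⟩ := nf_mem gs hv m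
  exact ⟨x, hx, h.symm⟩

theorem wsum_mem {gs : List Sh} (hv : ∀ g ∈ gs, valid g = true) (ms : List ℕ) :
    phi (wsum gs ms) ∈ Submodule.span (ZMod 2) (CC gs) := by
  induction ms with
  | nil => rw [wsum, phi_zero]; exact Submodule.zero_mem _
  | cons m ms ih =>
    rw [wsum, phi_xor]
    exact Submodule.add_mem _ (Submodule.subset_span (wd_mem hv m)) ih

theorem HH_full_card {gs : List Sh} {cs : List (ℕ × List ℕ)} (h : certOK gs cs = true)
    (hl : gs.length = 11) (hw : dfs chk gs.reverse 0 = true) :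
    Nat.card (HH gs) * (Fintype.card (Fin 15) + 1) = 2 ^ Fintype.card (Fin 15) := by
  rw [HH_card gs cs h (dfs_spec _ _ _ hw), hl]
  simp

theorem code_rank {gs : List Sh} (hv : ∀ g ∈ gs, valid g = true)
    (d : ℕ) (u : Fin d → ℕ) (p : Fin d → Fin 15) (Us : List ℕ) (B : List (List ℕ)) (bl : List ℕ)
    (hp : ∀ a b, phi (u a) (p b) = if a = b then 1 else 0) (hu : ∀ a, u a ∈ Us)
    (h1 : ∀ g ∈ gs, ∀ u ∈ Us, ∑ i, phi u i * phi g.1 i = 0)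
    (h2 : ∀ g ∈ gs, ∀ u ∈ Us, permN g.2 u ∈ Us)
    (hB : ∀ i : Fin 15, wsum gs (B.getD i []) = bl.getD i 0)
    (hb : ∀ i : Fin 15, phi (bl.getD i 0) = err (some i) + ∑ a, phi (u a) i • err (some (p a))) :
    Module.finrank (ZMod 2) (Submodule.span (ZMod 2) (CC gs)) + d = 15 := by
  refine rank_lemma d u p hp _ (fun x hx a => orth h1 h2 x hx _ (hu a)) ?_
  intro i
  rw [← hb i, ← hB i]
  exact wsum_mem hv _

theorem code_ex {gs : List Sh} {cs : List (ℕ × List ℕ)} (h : certOK gs cs = true)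
    (hl : gs.length = 11) (hw : dfs chk gs.reverse 0 = true)
    (d : ℕ) (u : Fin d → ℕ) (p : Fin d → Fin 15) (Us : List ℕ) (B : List (List ℕ)) (bl : List ℕ)
    (hp : ∀ a b, phi (u a) (p b) = if a = b then 1 else 0) (hu : ∀ a, u a ∈ Us)
    (h1 : ∀ g ∈ gs, ∀ u ∈ Us, ∑ i, phi u i * phi g.1 i = 0)
    (h2 : ∀ g ∈ gs, ∀ u ∈ Us, permN g.2 u ∈ Us)
    (hB : ∀ i : Fin 15, wsum gs (B.getD i []) = bl.getD i 0)
    (hb : ∀ i : Fin 15, phi (bl.getD i 0) = err (some i) + ∑ a, phi (u a) i • err (some (p a))) :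
    Ex 4 d := by
  refine ⟨Fin 15, inferInstance, inferInstance, CC gs, by simp, ?_⟩
  refine of_subgroup (HH gs) d (HH_full_card h hl hw) (HH_dist h (dfs_spec _ _ _ hw)) ?_
  rw [Fintype.card_fin]
  exact code_rank (certOK_valid _ _ h) d u p Us B bl hp hu h1 h2 hB hb

theorem vas_mem {gs : List Sh} (hv : ∀ g ∈ gs, valid g = true) (a b : Fin 15) (ms : List ℕ) :
    (phi (wsum gs ms), (ms.map (fun m => phi (wd gs m) a * phi (wd gs m) b)).sum) ∈
      Submodule.span (ZMod 2)
        {p : (Fin 15 → ZMod 2) × ZMod 2 | p.1 ∈ CC gs ∧ p.2 = p.1 a * p.1 b} := by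
  induction ms with
  | nil => rw [wsum, phi_zero]; exact Submodule.zero_mem _
  | cons m ms ih =>
    rw [wsum, phi_xor, List.map_cons, List.sum_cons, ← Prod.mk_add_mk]
    exact Submodule.add_mem _ (Submodule.subset_span ⟨wd_mem hv m, rfl⟩) ih

theorem vas_ex {gs : List Sh} {cs : List (ℕ × List ℕ)} (h : certOK gs cs = true)
    (hl : gs.length = 11) (hw : dfs chk gs.reverse 0 = true)
    (hr : Module.finrank (ZMod 2) (Submodule.span (ZMod 2) (CC gs)) = 15)
    (a b : Fin 15) (hab : ∀ g ∈ gs, (g.2.getD a 0 = a ∧ g.2.getD b 0 = b) ∨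
      (g.2.getD a 0 = b ∧ g.2.getD b 0 = a))
    (ms : List ℕ) (hm : wsum gs ms = 0)
    (hm' : (ms.map (fun m => phi (wd gs m) a * phi (wd gs m) b)).sum = 1) : Ex 5 0 := by
  have hv := certOK_valid _ _ h
  have hd := HH_dist h (dfs_spec _ _ _ hw)
  obtain ⟨P, hPs, hP⟩ := sub_prop (HH gs) hd
  have hperm : ∀ x ∈ HH gs, (x.s a = a ∧ x.s b = b) ∨ (x.s a = b ∧ x.s b = a) := by
    intro x hx
    unfold HH at hx
    induction hx using Subgroup.closure_induction with
    | mem x hx =>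
      obtain ⟨g, hg, hr⟩ := hx
      have := hab g hg
      rw [hr.2, plist_getD, plist_getD] at this
      simpa only [Fin.val_inj] using this
    | one => exact Or.inl ⟨rfl, rfl⟩
    | mul x y _ _ hx hy =>
      simp only [mul_s, Equiv.Perm.mul_apply]
      rcases hy with ⟨h1, h2⟩ | ⟨h1, h2⟩ <;> rw [h1, h2]
      · exact hx
      · rcases hx with ⟨h3, h4⟩ | ⟨h3, h4⟩
        · exact Or.inr ⟨h4, h3⟩
        · exact Or.inl ⟨h4, h3⟩
    | inv x _ hx =>
      simp only [inv_s, Equiv.Perm.inv_eq_iff_eq]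
      rcases hx with ⟨h3, h4⟩ | ⟨h3, h4⟩
      · exact Or.inl ⟨h3.symm, h4.symm⟩
      · exact Or.inr ⟨h4.symm, h3.symm⟩
  have htop : Submodule.span (ZMod 2) (CC gs) = ⊤ := by
    apply Submodule.eq_top_of_finrank_eq
    rw [hr, Module.finrank_fintype_fun_eq_card, Fintype.card_fin]
  refine ⟨ZMod 2 × Fin 15 ⊕ Unit, inferInstance, inferInstance, _, ?_,
    vasil (D := CC gs) a b ⟨1, Subgroup.one_mem _, rfl⟩
      (sub_perf (HH gs) (HH_full_card h hl hw) hd) P hP ?_ ?_⟩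
  · simp [ZMod.card]
  · rintro _ ⟨x, hx, rfl⟩
    rw [hPs x hx]
    exact hperm x hx
  · have h01 := vas_mem hv a b ms
    rw [hm, hm', phi_zero] at h01
    rw [eq_top_iff]
    rintro ⟨y, c⟩ -
    have hy : y ∈ Submodule.span (ZMod 2) (CC gs) := by rw [htop]; trivial
    have hex : ∃ c', (y, c') ∈ Submodule.span (ZMod 2)
        {p : (Fin 15 → ZMod 2) × ZMod 2 | p.1 ∈ CC gs ∧ p.2 = p.1 a * p.1 b} := by
      induction hy using Submodule.span_induction with
      | mem y hy => exact ⟨_, Submodule.subset_span ⟨hy, rfl⟩⟩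
      | zero => exact ⟨0, Submodule.zero_mem _⟩
      | add x y _ _ hx hy =>
        obtain ⟨c1, h1⟩ := hx
        obtain ⟨c2, h2⟩ := hy
        exact ⟨c1 + c2, Submodule.add_mem _ h1 h2⟩
      | smul k x _ hx =>
        obtain ⟨c1, h1⟩ := hx
        exact ⟨k • c1, Submodule.smul_mem _ k h1⟩
    obtain ⟨c', hc'⟩ := hex
    have := Submodule.add_mem _ hc' (Submodule.smul_mem _ (c - c') h01)
    simpa using this

end rank

section data

/-- generators of the code of defect 0 -/
def gs0 : List Sh :=
  [(2899, [0, 1, 2, 3, 7, 6, 5, 4, 8, 9, 10, 11, 12, 13, 14]),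
    (355, [0, 1, 2, 3, 5, 4, 7, 6, 8, 9, 10, 11, 13, 12, 14]),
    (4197, [1, 0, 3, 2, 5, 4, 7, 6, 9, 8, 10, 11, 12, 13, 14]),
    (4151, [1, 0, 2, 3, 4, 5, 6, 7, 9, 8, 10, 11, 12, 13, 14]),
    (4099, [0, 1, 2, 3, 4, 5, 6, 7, 9, 8, 10, 11, 12, 13, 14]),
    (7782, [1, 0, 3, 2, 5, 4, 7, 6, 9, 8, 10, 11, 13, 12, 14]),
    (790, [1, 0, 3, 2, 4, 5, 7, 6, 8, 9, 11, 10, 12, 13, 14]),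
    (240, [0, 1, 2, 3, 4, 5, 6, 7, 8, 9, 10, 11, 12, 13, 14]),
    (13311, [0, 1, 2, 3, 4, 5, 6, 7, 8, 9, 10, 11, 12, 13, 14]),
    (13296, [0, 1, 2, 3, 4, 5, 6, 7, 8, 9, 10, 11, 12, 13, 14]),
    (32767, [0, 1, 2, 3, 4, 5, 6, 7, 8, 9, 10, 11, 12, 13, 14])]

/-- certificate of the code of defect 0 -/
def cs0 : List (ℕ × List ℕ) :=
  [(64, [65, 66, 68, 8, 80, 435, 64, 128, 256, 512]),
    (32, [161, 162, 164, 168, 48, 32, 64, 128, 256]),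
    (112, [97, 2, 84, 24, 16, 32, 64, 128]),
    (0, [1, 26, 52, 8, 16, 32, 64]),
    (0, [21, 2, 4, 8, 16, 32]),
    (4, [3, 2, 4, 8, 16]),
    (6, [1, 2, 4, 8]),
    (0, [1, 2, 4]),
    (0, [1, 2]),
    (0, [1]),
    (0, [])]

theorem cert0 : certOK gs0 cs0 = true := by decide +kernel

theorem dfs0 : dfs chk gs0.reverse 0 = true := by decide +kernel

theorem ex4_0 : Ex 4 0 :=
  code_ex cert0 rfl dfs0 0 ![] ![]
    []
    [[1, 68, 841], [1, 64, 205], [2, 76, 982], [2, 64, 858], [2, 7, 721], [2, 5, 723], [2, 4, 722], [2, 6, 720], [5, 72, 207], [5, 74, 589], [7, 72, 360], [4, 74, 591], [4, 8, 796], [6, 12, 922], [3, 64, 1637]]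
    [1, 2, 4, 8, 16, 32, 64, 128, 256, 512, 1024, 2048, 4096, 8192, 16384]
    (by decide +kernel) (by decide +kernel) (by decide +kernel) (by decide +kernel)
    (by decide +kernel) (by decide +kernel)

theorem ex5_0 : Ex 5 0 :=
  vas_ex cert0 rfl dfs0
    (code_rank (certOK_valid _ _ cert0) 0 ![] ![]
    []
    [[1, 68, 841], [1, 64, 205], [2, 76, 982], [2, 64, 858], [2, 7, 721], [2, 5, 723], [2, 4, 722], [2, 6, 720], [5, 72, 207], [5, 74, 589], [7, 72, 360], [4, 74, 591], [4, 8, 796], [6, 12, 922], [3, 64, 1637]]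
    [1, 2, 4, 8, 16, 32, 64, 128, 256, 512, 1024, 2048, 4096, 8192, 16384]
    (by decide +kernel) (by decide +kernel) (by decide +kernel) (by decide +kernel)
    (by decide +kernel) (by decide +kernel))
    0 1 (by decide +kernel) [1, 1979, 0, 1850] (by decide +kernel) (by decide +kernel)

/-- generators of the code of defect 1 -/
def gs1 : List Sh :=
  [(595, [3, 2, 1, 0, 5, 4, 7, 6, 8, 9, 11, 10, 13, 12, 14]),
    (292, [4, 5, 7, 6, 3, 2, 0, 1, 11, 10, 8, 9, 13, 12, 14]),
    (1396, [4, 5, 7, 6, 0, 1, 3, 2, 11, 10, 9, 8, 12, 13, 14]),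
    (1616, [3, 2, 1, 0, 6, 7, 4, 5, 9, 8, 11, 10, 12, 13, 14]),
    (608, [1, 0, 3, 2, 7, 6, 5, 4, 8, 9, 11, 10, 13, 12, 14]),
    (22799, [0, 1, 2, 3, 4, 5, 6, 7, 8, 9, 10, 11, 12, 13, 14]),
    (27136, [0, 1, 2, 3, 4, 5, 6, 7, 8, 9, 10, 11, 12, 13, 14]),
    (10496, [0, 1, 2, 3, 4, 5, 6, 7, 8, 9, 10, 11, 12, 13, 14]),
    (13056, [0, 1, 2, 3, 4, 5, 6, 7, 8, 9, 10, 11, 12, 13, 14]),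
    (3840, [0, 1, 2, 3, 4, 5, 6, 7, 8, 9, 10, 11, 12, 13, 14]),
    (32767, [0, 1, 2, 3, 4, 5, 6, 7, 8, 9, 10, 11, 12, 13, 14])]

/-- certificate of the code of defect 1 -/
def cs1 : List (ℕ × List ℕ) :=
  [(992, [1006, 269, 740, 8, 400, 416, 448, 128, 256, 512]),
    (298, [91, 498, 302, 312, 80, 224, 192, 128, 256]),
    (184, [185, 47, 252, 72, 16, 96, 64, 128]),
    (32, [33, 34, 36, 40, 16, 32, 64]),
    (0, [25, 26, 28, 8, 16, 32]),
    (0, [1, 2, 4, 8, 16]),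
    (0, [1, 2, 4, 8]),
    (0, [1, 2, 4]),
    (0, [1, 2]),
    (0, [1]),
    (0, [])]

theorem cert1 : certOK gs1 cs1 = true := by decide +kernel

theorem dfs1 : dfs chk gs1.reverse 0 = true := by decide +kernel

theorem ex4_1 : Ex 4 1 :=
  code_ex cert1 rfl dfs1 1 ![255] ![0]
    [255]
    [[], [3, 4, 1494], [1, 2, 1708], [3, 5, 6], [2, 6, 377], [1, 5, 25], [2, 4, 869], [1, 4, 870], [3, 5, 1192], [2, 4, 8], [1, 3, 381], [1, 2, 1724], [2, 3, 1367], [4, 5, 247], [1, 6, 1127]]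
    [0, 3, 5, 9, 17, 33, 65, 129, 256, 512, 1024, 2048, 4096, 8192, 16384]
    (by decide +kernel) (by decide +kernel) (by decide +kernel) (by decide +kernel)
    (by decide +kernel) (by decide +kernel)

/-- generators of the code of defect 2 -/
def gs2 : List Sh :=
  [(8638, [6, 7, 5, 4, 3, 2, 0, 1, 8, 9, 10, 11, 12, 13, 14]),
    (13824, [0, 1, 2, 3, 4, 5, 6, 7, 8, 9, 10, 11, 12, 13, 14]),
    (4965, [0, 1, 2, 3, 4, 5, 6, 7, 8, 9, 10, 11, 12, 13, 14]),
    (21739, [7, 6, 4, 5, 2, 3, 1, 0, 8, 9, 10, 11, 12, 13, 14]),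
    (255, [0, 1, 2, 3, 4, 5, 6, 7, 8, 9, 10, 11, 12, 13, 14]),
    (7490, [7, 6, 4, 5, 2, 3, 1, 0, 8, 9, 10, 11, 12, 13, 14]),
    (23658, [0, 1, 2, 3, 4, 5, 6, 7, 8, 9, 10, 11, 12, 13, 14]),
    (2047, [0, 1, 2, 3, 4, 5, 6, 7, 8, 9, 10, 11, 12, 13, 14]),
    (2781, [4, 5, 7, 6, 0, 1, 3, 2, 8, 9, 10, 11, 12, 13, 14]),
    (9512, [7, 6, 4, 5, 2, 3, 1, 0, 8, 9, 10, 11, 12, 13, 14]),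
    (32767, [0, 1, 2, 3, 4, 5, 6, 7, 8, 9, 10, 11, 12, 13, 14])]

/-- certificate of the code of defect 2 -/
def cs2 : List (ℕ × List ℕ) :=
  [(0, [1, 2, 12, 8, 16, 40, 64, 136, 264, 512]),
    (0, [1, 2, 4, 8, 16, 32, 64, 128, 256]),
    (0, [3, 2, 6, 8, 16, 34, 66, 128]),
    (0, [1, 2, 4, 8, 17, 32, 64]),
    (0, [1, 2, 4, 8, 16, 32]),
    (0, [1, 2, 4, 8, 16]),
    (0, [1, 2, 4, 8]),
    (0, [1, 2, 4]),
    (0, [1, 2]),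
    (0, [1]),
    (0, [])]

theorem cert2 : certOK gs2 cs2 = true := by decide +kernel

theorem dfs2 : dfs chk gs2.reverse 0 = true := by decide +kernel

theorem ex4_2 : Ex 4 2 :=
  code_ex cert2 rfl dfs2 2 ![13993, 13910] ![0, 1]
    [255, 13910, 13993]
    [[], [], [1, 8, 812], [1, 9, 1799], [1, 9, 1297], [1, 8, 298], [1, 256, 775], [1, 257, 774], [1, 256, 509], [257, 892], [1579], [1, 264, 1917], [256, 901], [1, 1744], [1, 8, 643]]
    [0, 0, 6, 9, 18, 33, 66, 129, 256, 515, 1027, 2048, 4099, 8195, 16384]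
    (by decide +kernel) (by decide +kernel) (by decide +kernel) (by decide +kernel)
    (by decide +kernel) (by decide +kernel)

/-- generators of the code of defect 3 -/
def gs3 : List Sh :=
  [(18495, [0, 1, 2, 3, 4, 5, 6, 7, 8, 9, 10, 11, 12, 13, 14]),
    (20278, [0, 1, 2, 3, 4, 5, 6, 7, 9, 8, 10, 11, 12, 13, 14]),
    (12178, [0, 1, 2, 3, 4, 5, 6, 7, 8, 9, 10, 11, 12, 13, 14]),
    (7394, [0, 1, 2, 3, 4, 5, 6, 7, 8, 9, 10, 11, 12, 13, 14]),
    (12127, [0, 1, 2, 3, 4, 5, 6, 7, 8, 9, 10, 11, 12, 13, 14]),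
    (23489, [0, 1, 2, 3, 4, 5, 6, 7, 8, 9, 10, 11, 12, 13, 14]),
    (31058, [0, 1, 3, 2, 4, 5, 6, 7, 8, 9, 10, 11, 12, 13, 14]),
    (9968, [0, 1, 3, 2, 4, 5, 6, 7, 8, 9, 10, 11, 12, 13, 14]),
    (30559, [0, 1, 2, 3, 4, 5, 6, 7, 8, 9, 10, 11, 12, 13, 14]),
    (15330, [0, 1, 2, 3, 4, 5, 6, 7, 8, 9, 10, 11, 12, 13, 14]),
    (32767, [0, 1, 2, 3, 4, 5, 6, 7, 8, 9, 10, 11, 12, 13, 14])]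

/-- certificate of the code of defect 3 -/
def cs3 : List (ℕ × List ℕ) :=
  [(0, [1, 2, 4, 8, 16, 32, 64, 128, 256, 512]),
    (0, [1, 2, 4, 8, 89, 105, 64, 128, 256]),
    (0, [1, 2, 4, 8, 16, 32, 64, 128]),
    (0, [1, 2, 4, 8, 16, 32, 64]),
    (0, [1, 2, 4, 8, 16, 32]),
    (0, [1, 2, 4, 8, 16]),
    (0, [1, 2, 4, 8]),
    (0, [1, 2, 4]),
    (0, [1, 2]),
    (0, [1]),
    (0, [])]

theorem cert3 : certOK gs3 cs3 = true := by decide +kernel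

theorem dfs3 : dfs chk gs3.reverse 0 = true := by decide +kernel

theorem ex4_3 : Ex 4 3 :=
  code_ex cert3 rfl dfs3 3 ![16257, 19410, 27852] ![0, 1, 2]
    [6303, 10014, 16257, 19410, 21325, 27852, 29779]
    [[], [], [], [2, 64, 358], [2, 64, 1439], [2, 64, 659], [64, 854], [550], [2, 1206], [1204], [295], [64, 1463], [2, 64, 1915], [64, 879], [990]]
    [0, 0, 0, 12, 18, 32, 70, 135, 259, 515, 1029, 2055, 4097, 8197, 16390]
    (by decide +kernel) (by decide +kernel) (by decide +kernel) (by decide +kernel)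
    (by decide +kernel) (by decide +kernel)

end data

section fin

theorem zne (p q : ZMod 2) (h : p ≠ q) : q = p + 1 := by revert p q; decide

theorem dist_iff {n : ℕ} (x y : F n) : hammingDist x y ≤ 1 ↔ ∃ e : Option (Fin n), y = x + err e := by
  constructor
  · intro h
    rcases Nat.le_one_iff_eq_zero_or_eq_one.mp h with h | h
    · refine ⟨none, ?_⟩
      rw [hammingDist_eq_zero.mp h]; simp [err]
    · unfold hammingDist at h
      obtain ⟨i, hi⟩ := Finset.card_eq_one.mp h
      refine ⟨some i, ?_⟩
      funext j
      have hj : x j ≠ y j ↔ j = i := by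
        have := Finset.ext_iff.mp hi j
        simpa using this
      by_cases hji : j = i
      · subst hji
        have := zne _ _ (hj.mpr rfl)
        simp [err, this]
      · have : x j = y j := by
          by_contra hne
          exact hji (hj.mp hne)
        simp [err, hji, this]
  · rintro ⟨e, rfl⟩
    cases e with
    | none => simp [err]
    | some i =>
      unfold hammingDist
      refine (Finset.card_le_card (t := {i}) ?_).trans (by simp)
      intro j hj
      simp only [Finset.mem_filter, Finset.mem_univ, true_and, Pi.add_apply, err] at hj
      rw [Finset.mem_singleton]
      by_contra hne
      simp [Pi.single_apply, hne] at hj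

theorem fin_of_ppc {n d r : ℕ} (C : Set (F n)) (h : IsPPC C d) (hr : r + d = n) :
    IsPerfectCode C ∧ (0 : F n) ∈ C ∧ IsPropelinear C ∧ codeRank C = r := by
  refine ⟨?_, h.zero, ?_, ?_⟩
  · intro x
    obtain ⟨e, he, hu⟩ := h.perf x
    refine ⟨x + err e, ⟨he, (dist_iff _ _).mpr ⟨e, rfl⟩⟩, ?_⟩
    rintro y ⟨hy, hd⟩
    obtain ⟨e', rfl⟩ := (dist_iff _ _).mp hd
    rw [hu e' hy]
  · obtain ⟨P, hP⟩ := h.prop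
    refine ⟨P, ?_, fun x hx y hy => (hP x hx y hy).2⟩
    intro x hx
    refine Set.eq_of_subset_of_ncard_le ?_ ?_ (Set.toFinite _)
    · rintro _ ⟨y, hy, rfl⟩
      exact (hP x hx y hy).1
    · rw [Set.ncard_image_of_injective]
      intro y z hyz
      have h1 : act (P x) y = act (P x) z := add_left_cancel hyz
      have h2 := congrArg (act (P x)⁻¹) h1
      rwa [← act_mul, ← act_mul, inv_mul_cancel, act_one, act_one] at h2
  · have h1 : codeRank C + d = n := by
      have := h.rank
      rwa [Fintype.card_fin] at this
    omega

theorem ppc_transport {ι κ : Type} [Fintype ι] [DecidableEq ι] [Fintype κ] [DecidableEq κ]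
    (e : ι ≃ κ) {C : Set (ι → ZMod 2)} {d : ℕ} (h : IsPPC C d) :
    IsPPC ((LinearEquiv.funCongrLeft (ZMod 2) (ZMod 2) e).toLinearMap ⁻¹' C) d := by
  have hs : Function.Surjective (LinearEquiv.funCongrLeft (ZMod 2) (ZMod 2) e).toLinearMap :=
    (LinearEquiv.funCongrLeft (ZMod 2) (ZMod 2) e).surjective
  refine ⟨?_, ?_, ?_, ?_⟩
  · rw [Set.mem_preimage, map_zero]; exact h.zero
  · intro v
    obtain ⟨x, hx, hu⟩ := h.perf (v ∘ e)
    have key : ∀ o : Option κ, (LinearEquiv.funCongrLeft (ZMod 2) (ZMod 2) e).toLinearMap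
        (v + err o) = v ∘ e + err (o.map e.symm) := by
      intro o
      funext i
      cases o with
      | none => rfl
      | some k =>
        change v (e i) + (Pi.single k 1 : κ → ZMod 2) (e i) =
          v (e i) + (Pi.single (e.symm k) 1 : ι → ZMod 2) i
        simp only [Pi.single_apply, Equiv.eq_symm_apply]
    refine ⟨x.map e, ?_, ?_⟩
    · change _ ∈ C
      rw [key]
      simpa using hx
    · intro o ho
      change _ ∈ C at ho
      rw [key] at ho
      have := hu _ ho
      rw [← this]
      simp
  · obtain ⟨P, hP⟩ := h.prop
    refine ⟨fun w => e.permCongr (P (w ∘ e)), ?_⟩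
    intro x hx y hy
    have h1 := hP _ hx _ hy
    have key : (x + act (e.permCongr (P (x ∘ e))) y) ∘ e = x ∘ e + act (P (x ∘ e)) (y ∘ e) := by
      funext i
      change x (e i) + y ((e.permCongr (P (x ∘ e)))⁻¹ (e i)) = x (e i) + y (e ((P (x ∘ e))⁻¹ i))
      congr 2
      rw [Equiv.Perm.inv_eq_iff_eq]
      simp [Equiv.permCongr_apply]
    constructor
    · change (x + act (e.permCongr (P (x ∘ e))) y) ∘ e ∈ C
      rw [key]; exact h1.1
    · beta_reduce
      rw [key]
      refine Eq.trans (congrArg e.permCongr h1.2) ?_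
      ext k
      simp [Equiv.permCongr_apply]
      rfl
  · rw [span_preimage _ hs _ h.zero]
    have h1 := finrank_comap _ hs (Submodule.span (ZMod 2) C)
    have h2 := h.rank
    have h3 := Fintype.card_congr e
    simp only [Module.finrank_fintype_fun_eq_card] at h1
    omega

theorem Ex.fin {m d r : ℕ} (h : Ex m d) (hr : r + d = 2 ^ m - 1) :
    ∃ C : Set (F (2 ^ m - 1)),
      IsPerfectCode C ∧ (0 : F (2 ^ m - 1)) ∈ C ∧ IsPropelinear C ∧ codeRank C = r := by
  obtain ⟨ι, _, _, C, hc, hC⟩ := h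
  have e : ι ≃ Fin (2 ^ m - 1) := Fintype.equivFinOfCardEq (by omega)
  exact ⟨_, fin_of_ppc _ (ppc_transport e hC) hr⟩

end fin

/-- all defects are realised -/
def Good (m : ℕ) : Prop := ∀ d ≤ m, Ex m d

theorem Good.add {a b : ℕ} (ha : Good a) (hb : Good b) : Good (a + b) := by
  intro d hd
  have : d = min d a + (d - min d a) := by omega
  rw [this]
  exact (ha _ (by omega)).add (hb _ (by omega))

theorem all_ex (h4 : ∀ d ≤ 3, Ex 4 d) (h5 : Ex 5 0) (m : ℕ) (hm : 4 ≤ m) (d : ℕ) (hd : d ≤ m)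
    (hexc : ¬((m = 6 ∧ d = 0) ∨ (m = 7 ∧ d = 1) ∨ (m = 7 ∧ d = 0) ∨ (m = 11 ∧ d = 0))) :
    Ex m d := by
  have e22 : Ex 2 2 := Ex.base.add Ex.base
  have g4 : Good 4 := by
    intro d hd
    by_cases h : d ≤ 3
    · exact h4 d h
    · have : d = 4 := by omega
      rw [this]
      exact e22.add e22
  have step : ∀ m, (∀ d ≤ m, Ex m d) → ∀ d, 1 ≤ d → d ≤ m + 1 → Ex (m + 1) d := by
    intro m hm d h1 h2
    have := (hm (d - 1) (by omega)).add Ex.base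
    rwa [Nat.sub_add_cancel h1] at this
  have g5 : Good 5 := by
    intro d hd
    by_cases h : d = 0
    · rw [h]; exact h5
    · exact step 4 g4 d (by omega) hd
  have g8 : Good 8 := g4.add g4
  have g9 : Good 9 := g4.add g5
  have g10 : Good 10 := g5.add g5
  have g12 : Good 12 := g4.add g8
  have g13 : Good 13 := g4.add g9
  have g14 : Good 14 := g5.add g9
  have g15 : Good 15 := g5.add g10
  have gbig : ∀ m, 12 ≤ m → Good m := by
    intro m
    induction m using Nat.strong_induction_on with
    | _ m ih =>
      intro hm
      by_cases h : m < 16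
      · interval_cases m
        · exact g12
        · exact g13
        · exact g14
        · exact g15
      · have := g4.add (ih (m - 4) (by omega) (by omega))
        rwa [show 4 + (m - 4) = m by omega] at this
  by_cases h : 12 ≤ m
  · exact gbig m h d hd
  · interval_cases m
    · exact g4 d hd
    · exact g5 d hd
    · exact step 5 g5 d (by omega) hd
    · have := (g5 (d - 2) (by omega)).add e22
      rwa [Nat.sub_add_cancel (by omega)] at this
    · exact g8 d hd
    · exact g9 d hd
    · exact g10 d hd
    · exact step 10 g10 d (by omega) hd

theorem final (h4 : ∀ d ≤ 3, Ex 4 d) (h5 : Ex 5 0)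
    (m : ℕ) (hm : 4 ≤ m) (r : ℕ)
    (hr1 : 2 ^ m - 1 - m ≤ r) (hr2 : r ≤ 2 ^ m - 1)
    (hexc : ¬((m = 6 ∧ r = 63) ∨ (m = 7 ∧ r = 126) ∨ (m = 7 ∧ r = 127) ∨
      (m = 11 ∧ r = 2047))) :
    ∃ C : Set (F (2 ^ m - 1)),
      IsPerfectCode C ∧ (0 : F (2 ^ m - 1)) ∈ C ∧ IsPropelinear C ∧ codeRank C = r := by
  refine Ex.fin (d := 2 ^ m - 1 - r) (all_ex h4 h5 m hm _ (by omega) ?_) (by omega)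
  intro h
  apply hexc
  rcases h with ⟨rfl, h⟩ | ⟨rfl, h⟩ | ⟨rfl, h⟩ | ⟨rfl, h⟩ <;> norm_num at hr1 hr2 h ⊢ <;> omega

theorem h4 : ∀ d ≤ 3, Ex 4 d := by
  intro d hd
  interval_cases d
  · exact ex4_0
  · exact ex4_1
  · exact ex4_2
  · exact ex4_3

end PPC

/-- For every `m ≥ 4` and every rank `r` with `2^m - 1 - m ≤ r ≤ 2^m - 1`,
excluding `(m,r) ∈ {(6,63), (7,126), (7,127), (11,2047)}`, there exists a
propelinear perfect binary code of length `2^m - 1` containing `0` with rank `r`. -/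
theorem ranks_of_propelinear_perfect_codes
    (m : ℕ) (hm : 4 ≤ m) (r : ℕ)
    (hr1 : 2 ^ m - 1 - m ≤ r) (hr2 : r ≤ 2 ^ m - 1)
    (hexc : ¬((m = 6 ∧ r = 63) ∨ (m = 7 ∧ r = 126) ∨ (m = 7 ∧ r = 127) ∨
      (m = 11 ∧ r = 2047))) :
    ∃ C : Set (F (2 ^ m - 1)),
      IsPerfectCode C ∧ (0 : F (2 ^ m - 1)) ∈ C ∧ IsPropelinear C ∧ codeRank C = r := by
  exact PPC.final PPC.h4 PPC.ex5_0 m hm r hr1 hr2 hexc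
end

section
/- For every r ∈ {11, 12, 13, 14, 15} there exists a propelinear perfect binary code C of length 15 containing the all-zero vector with rank equal to r. -/
open Finset

namespace PropCode

def xorB : ℕ → (ℕ → ℕ) → ℕ
  | 0, _ => 0
  | n + 1, f => f n ^^^ xorB n f

def orB : ℕ → (ℕ → ℕ) → ℕ
  | 0, _ => 0
  | n + 1, f => f n ||| orB n f

def allB : ℕ → (ℕ → Bool) → Bool
  | 0, _ => true
  | n + 1, f => f n && allB n f

/-- Packed data describing a code of length 15 by syndromes. -/
structure Dat where
  n : ℕ
  m : ℕ
  r : ℕ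
  q : ℕ
  h : ℕ
  s : ℕ
  p : ℕ
  a : ℕ
  mu : ℕ
  ic : ℕ
  w : ℕ
  wi : ℕ
  l : ℕ

namespace Dat

def N (d : Dat) : ℕ := 2 ^ d.n
/-- columns of the parity check matrix -/
def hc (d : Dat) (i : ℕ) : ℕ := (d.h >>> (16 * i)) % 65536
/-- syndromes of the codewords -/
def sc (d : Dat) (j : ℕ) : ℕ := (d.s >>> (16 * j)) % 65536
/-- permutations -/
def pc (d : Dat) (j i : ℕ) : ℕ := (d.p >>> (64 * j + 4 * i)) % 16
/-- matrices of the generators -/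
def ac (d : Dat) (b c : ℕ) : ℕ := (d.a >>> (256 * b + 16 * c)) % 65536
/-- multiplication table -/
def mc (d : Dat) (b l : ℕ) : ℕ := (d.mu >>> (1024 * b + 8 * l)) % 256
def icc (d : Dat) (b : ℕ) : ℕ := (d.ic >>> (4 * b)) % 16
def wc (d : Dat) (a : ℕ) : ℕ := (d.w >>> (16 * a)) % 65536
def wic (d : Dat) (a : ℕ) : ℕ := (d.wi >>> (8 * a)) % 256
def lc (d : Dat) (i : ℕ) : ℕ := (d.l >>> (16 * i)) % 65536
def aAct (d : Dat) (b y : ℕ) : ℕ := xorB d.m fun c => bif y.testBit c then d.ac b c else 0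
def linN (h : ℕ → ℕ) (w : ℕ) : ℕ := xorB 15 fun i => bif w.testBit i then h i else 0

def c1 (d : Dat) : Bool :=
  Nat.beq (orB d.N fun j => orB 16 fun i => 1 <<< (d.sc j ^^^ d.hc i)) (2 ^ (2 ^ d.m) - 1)
def c1b (d : Dat) : Bool :=
  Nat.beq (d.N * 16) (2 ^ d.m) && Nat.beq (d.hc 15) 0 &&
    allB 15 (fun i => Nat.blt (d.hc i) (2 ^ d.m)) && allB d.N (fun j => Nat.blt (d.sc j) (2 ^ d.m))
def c2 (d : Dat) : Bool :=
  allB d.N fun j => Nat.beq (orB 15 fun i => 1 <<< d.pc j i) 32767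
def c2b (d : Dat) : Bool :=
  allB d.N fun j => allB 15 fun i => Nat.blt (d.pc j i) 15
def c3 (d : Dat) : Bool :=
  allB d.n fun b => allB 15 fun i =>
    Nat.beq (d.aAct b (d.hc i)) (d.hc (d.pc (2 ^ b) i))
def c4 (d : Dat) : Bool :=
  allB d.n fun b => allB d.N fun l =>
    Nat.blt (d.mc b l) d.N &&
    Nat.beq (d.sc (d.mc b l)) (d.sc (2 ^ b) ^^^ d.aAct b (d.sc l)) &&
    allB 15 fun i => Nat.beq (d.pc (d.mc b l) i) (d.pc (2 ^ b) (d.pc l i))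
def c5 (d : Dat) : Bool :=
  allB d.n fun b => allB (2 ^ b) fun l => Nat.beq (d.mc b l) (2 ^ b + l)
def c6 (d : Dat) : Bool :=
  Nat.beq (d.sc 0) 0 && allB 15 fun i => Nat.beq (d.pc 0 i) i
def c7 (d : Dat) : Bool :=
  Nat.ble d.r 15 && allB d.N (fun j => Nat.blt (d.sc j) (2 ^ d.q)) &&
    allB (15 - d.r) fun b => Nat.blt (d.icc b) 15 && Nat.beq (d.hc (d.icc b) >>> d.q) (2 ^ b)
def c8 (d : Dat) : Bool :=
  allB d.r fun a => Nat.blt (d.wic a) d.N &&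
    Nat.beq (linN d.hc (d.wc a)) (d.sc (d.wic a)) && Nat.beq (linN d.lc (d.wc a)) (2 ^ a)

end Dat

structure Good (d : Dat) : Prop where
  h1 : d.c1 = true
  h1b : d.c1b = true
  h2 : d.c2 = true
  h2b : d.c2b = true
  h3 : d.c3 = true
  h4 : d.c4 = true
  h5 : d.c5 = true
  h6 : d.c6 = true
  h7 : d.c7 = true
  h8 : d.c8 = true

theorem allB_iff {n : ℕ} {f : ℕ → Bool} : allB n f = true ↔ ∀ i < n, f i = true := by
  induction n with
  | zero => simp [allB]
  | succ n ih =>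
    rw [allB, Bool.and_eq_true, ih]
    constructor
    · rintro ⟨h1, h2⟩ i hi
      rcases Nat.lt_succ_iff_lt_or_eq.mp hi with h | h
      · exact h2 i h
      · exact h ▸ h1
    · intro h
      exact ⟨h n (by omega), fun i hi => h i (by omega)⟩

theorem orB_testBit {n : ℕ} {f : ℕ → ℕ} {y : ℕ} :
    (orB n f).testBit y = true ↔ ∃ i < n, (f i).testBit y = true := by
  induction n with
  | zero => simp [orB]
  | succ n ih =>
    rw [orB, Nat.testBit_or, Bool.or_eq_true, ih]
    constructor
    · rintro (h | ⟨i, hi, h⟩)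
      · exact ⟨n, by omega, h⟩
      · exact ⟨i, by omega, h⟩
    · rintro ⟨i, hi, h⟩
      rcases Nat.lt_succ_iff_lt_or_eq.mp hi with h' | h'
      · exact Or.inr ⟨i, h', h⟩
      · exact Or.inl (h' ▸ h)

theorem xorB_xor (n : ℕ) (f g : ℕ → ℕ) :
    xorB n (fun i => f i ^^^ g i) = xorB n f ^^^ xorB n g := by
  induction n with
  | zero => simp [xorB]
  | succ n ih =>
    simp only [xorB, ih]
    ac_rfl

theorem xorB_congr {n : ℕ} {f g : ℕ → ℕ} (h : ∀ i < n, f i = g i) : xorB n f = xorB n g := by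
  induction n with
  | zero => rfl
  | succ n ih => rw [xorB, xorB, h n (by omega), ih (fun i hi => h i (by omega))]

theorem xorB_single (n i : ℕ) (f : ℕ → ℕ) :
    xorB n (fun k => if k = i then f k else 0) = if i < n then f i else 0 := by
  induction n with
  | zero => simp [xorB]
  | succ n ih =>
    rw [xorB, ih]
    by_cases h : n = i
    · subst h; simp
    · by_cases h2 : i < n
      · simp [h, h2, Nat.lt_succ_of_lt h2]
      · have : ¬ i < n + 1 := by omega
        simp [h, h2, this]

/-- extension of a vector by zero -/
def ext0 (x : F 15) (i : ℕ) : ZMod 2 := if h : i < 15 then x ⟨i, h⟩ else 0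

/-- xor of the columns selected by `x` -/
def lin (h : ℕ → ℕ) (x : F 15) : ℕ := xorB 15 fun i => if ext0 x i = 1 then h i else 0

theorem zmod2_cases (a : ZMod 2) : a = 0 ∨ a = 1 := by revert a; decide

theorem lin_add (h : ℕ → ℕ) (x y : F 15) : lin h (x + y) = lin h x ^^^ lin h y := by
  unfold lin
  rw [← xorB_xor]
  apply xorB_congr
  intro i hi
  have : ext0 (x + y) i = ext0 x i + ext0 y i := by simp [ext0, hi]
  rw [this]
  have h11 : (1 : ZMod 2) + 1 = 0 := by decide
  rcases zmod2_cases (ext0 x i) with h1 | h1 <;> rcases zmod2_cases (ext0 y i) with h2 | h2 <;>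
    simp [h1, h2, h11]

theorem lin_single (h : ℕ → ℕ) (i : Fin 15) : lin h (Pi.single i 1) = h i := by
  have := xorB_single 15 i h
  rw [if_pos i.isLt] at this
  rw [← this, lin]
  apply xorB_congr
  intro k hk
  by_cases hki : k = i
  · have : ext0 (Pi.single i 1) k = 1 := by simp [ext0, hki]
    rw [if_pos this, if_pos hki]
  · have : ext0 (Pi.single i 1) k = 0 := by
      simp only [ext0, hk, dif_pos]
      rw [Pi.single_eq_of_ne]
      intro hh; apply hki; rw [← hh]
    simp [this, hki]

theorem xhom_zero {V : Type*} [AddCommGroup V] {f : V → ℕ}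
    (hf : ∀ x y, f (x + y) = f x ^^^ f y) : f 0 = 0 := by
  have := hf 0 0
  simpa using this

theorem xhom_ext {f g : F 15 → ℕ} (hf : ∀ x y, f (x + y) = f x ^^^ f y)
    (hg : ∀ x y, g (x + y) = g x ^^^ g y)
    (h : ∀ i, f (Pi.single i 1) = g (Pi.single i 1)) (x : F 15) : f x = g x := by
  have key : ∀ s : Finset (Fin 15), f (∑ i ∈ s, Pi.single i (x i)) = g (∑ i ∈ s, Pi.single i (x i)) := by
    intro s
    induction s using Finset.induction_on with
    | empty => simp [xhom_zero hf, xhom_zero hg]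
    | insert a s ha ih =>
      rw [Finset.sum_insert ha, hf, hg, ih]
      rcases zmod2_cases (x a) with h1 | h1
      · simp [h1, xhom_zero hf, xhom_zero hg]
      · rw [h1, h]
  have := key Finset.univ
  rwa [Finset.univ_sum_single] at this

theorem permAct_add (π : Equiv.Perm (Fin 15)) (x y : F 15) :
    permAct π (x + y) = permAct π x + permAct π y := rfl

theorem permAct_mul (π ρ : Equiv.Perm (Fin 15)) (x : F 15) :
    permAct (π * ρ) x = permAct π (permAct ρ x) := by
  funext i; simp [permAct]

theorem permAct_single (π : Equiv.Perm (Fin 15)) (i : Fin 15) :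
    permAct π (Pi.single i 1) = Pi.single (π i) 1 := by
  funext k
  unfold permAct
  by_cases h : k = π i
  · subst h; simp
  · rw [Pi.single_eq_of_ne h, Pi.single_eq_of_ne]
    intro h2; apply h; rw [← h2]; simp

/-- vector of a number -/
def vec (w : ℕ) : F 15 := fun i => if w.testBit i then 1 else 0

theorem lin_vec (h : ℕ → ℕ) (w : ℕ) : lin h (vec w) = Dat.linN h w := by
  unfold lin Dat.linN
  apply xorB_congr
  intro i hi
  cases hw : w.testBit i <;> simp [ext0, vec, hi, hw]

theorem aAct_xor (d : Dat) (b y z : ℕ) : d.aAct b (y ^^^ z) = d.aAct b y ^^^ d.aAct b z := by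
  unfold Dat.aAct
  rw [← xorB_xor]
  apply xorB_congr
  intro i _
  rw [Nat.testBit_xor]
  cases y.testBit i <;> cases z.testBit i <;> simp

theorem xorB_lt {n m : ℕ} {f : ℕ → ℕ} (h : ∀ i < n, f i < 2 ^ m) : xorB n f < 2 ^ m := by
  induction n with
  | zero => simp [xorB]
  | succ n ih => exact Nat.xor_lt_two_pow (h n (by omega)) (ih fun i hi => h i (by omega))

theorem testBit_one_shl {a y : ℕ} : (1 <<< a).testBit y = true ↔ a = y := by
  rw [Nat.one_shiftLeft, Nat.testBit_two_pow]; simp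

section
variable {d : Dat}

open Classical in
/-- permutation number `j` -/
noncomputable def prm (d : Dat) (j : ℕ) : Equiv.Perm (Fin 15) :=
  if h : Function.Bijective (fun i : Fin 15 => Fin.ofNat 15 (d.pc j i)) then Equiv.ofBijective _ h else 1

theorem pc_lt (g : Good d) {j i : ℕ} (hj : j < d.N) (hi : i < 15) : d.pc j i < 15 := by
  have := g.h2b
  simp only [Dat.c2b, allB_iff, Nat.blt_eq] at this
  exact this j hj i hi

theorem prm_val (g : Good d) {j : ℕ} (hj : j < d.N) (i : Fin 15) : (prm d j i : ℕ) = d.pc j i := by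
  have h2 := g.h2
  simp only [Dat.c2, allB_iff, Nat.beq_eq] at h2
  have hb : Function.Bijective (fun i : Fin 15 => Fin.ofNat 15 (d.pc j i)) := by
    rw [← Finite.surjective_iff_bijective]
    intro k
    have : (32767 : ℕ).testBit k = true := by revert k; decide
    rw [← h2 j hj, orB_testBit] at this
    obtain ⟨i, hi, hk⟩ := this
    rw [testBit_one_shl] at hk
    refine ⟨⟨i, hi⟩, ?_⟩
    apply Fin.ext
    simp only [Fin.ofNat]
    rw [hk]; exact Nat.mod_eq_of_lt k.isLt
  rw [prm, dif_pos hb]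
  simp only [Equiv.ofBijective_apply, Fin.ofNat]
  exact Nat.mod_eq_of_lt (pc_lt g hj i.isLt)

def code (d : Dat) : Set (F 15) := {x | ∃ j < d.N, lin d.hc x = d.sc j}

/-- syndrome map of the pair -/
def pairMap (d : Dat) (g : Good d) (a : Fin d.N × Fin 16) : Fin (2 ^ d.m) :=
  ⟨d.sc a.1 ^^^ d.hc a.2, by
    have := g.h1b
    simp only [Dat.c1b, Bool.and_eq_true, allB_iff, Nat.blt_eq, Nat.beq_eq] at this
    obtain ⟨⟨⟨h1, h2⟩, h3⟩, h4⟩ := this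
    apply Nat.xor_lt_two_pow (h4 _ a.1.isLt)
    rcases Nat.lt_succ_iff_lt_or_eq.mp a.2.isLt with h | h
    · exact h3 _ h
    · rw [h, h2]; positivity⟩

theorem pairMap_bij (g : Good d) : Function.Bijective (pairMap d g) := by
  have hb := g.h1b
  simp only [Dat.c1b, Bool.and_eq_true, allB_iff, Nat.blt_eq, Nat.beq_eq] at hb
  obtain ⟨⟨⟨h1, -⟩, -⟩, -⟩ := hb
  rw [Fintype.bijective_iff_surjective_and_card]
  refine ⟨?_, by simp [h1]⟩
  intro y
  have hh := g.h1
  rw [Dat.c1, Nat.beq_eq] at hh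
  have : (2 ^ 2 ^ d.m - 1).testBit y = true := by
    rw [Nat.testBit_two_pow_sub_one]; simp
  rw [← hh, orB_testBit] at this
  obtain ⟨j, hj, hy⟩ := this
  rw [orB_testBit] at hy
  obtain ⟨i, hi, hy⟩ := hy
  rw [testBit_one_shl] at hy
  exact ⟨(⟨j, hj⟩, ⟨i, hi⟩), Fin.ext hy⟩

theorem pair_inj (g : Good d) {j j' i i' : ℕ} (hj : j < d.N) (hj' : j' < d.N) (hi : i < 16)
    (hi' : i' < 16) (h : d.sc j ^^^ d.hc i = d.sc j' ^^^ d.hc i') : j = j' ∧ i = i' := by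
  have := (pairMap_bij g).1 (a₁ := (⟨j, hj⟩, ⟨i, hi⟩)) (a₂ := (⟨j', hj'⟩, ⟨i', hi'⟩)) (Fin.ext h)
  simpa using this

theorem sc_inj (g : Good d) {j j' : ℕ} (hj : j < d.N) (hj' : j' < d.N)
    (h : d.sc j = d.sc j') : j = j' :=
  (pair_inj g hj hj' (i := 15) (i' := 15) (by omega) (by omega) (by rw [h])).1

/-- error vector; index 15 means no error -/
def err (i : ℕ) : F 15 := if h : i < 15 then Pi.single ⟨i, h⟩ 1 else 0

theorem lin_err (g : Good d) {i : ℕ} (hi : i < 16) : lin d.hc (err i) = d.hc i := by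
  unfold err
  split_ifs with h
  · rw [lin_single]
  · have hb := g.h1b
    simp only [Dat.c1b, Bool.and_eq_true, Nat.beq_eq] at hb
    have : i = 15 := by omega
    rw [xhom_zero (lin_add _), this, hb.1.1.2]

theorem dist_err (x : F 15) (i : ℕ) : hammingDist x (x + err i) ≤ 1 := by
  rw [hammingDist_eq_hammingNorm]
  have : -x + (x + err i) = err i := by abel
  rw [this]
  unfold err hammingNorm
  rw [Finset.card_le_one]
  intro a ha b hb
  simp only [Finset.mem_filter, Finset.mem_univ, true_and] at ha hb
  split_ifs at ha hb with h
  · simp [Pi.single_apply] at ha hb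
    rw [ha, hb]
  · simp at ha

theorem exists_err {x y : F 15} (h : hammingDist x y ≤ 1) : ∃ i < 16, y = x + err i := by
  unfold hammingDist at h
  rw [Finset.card_le_one] at h
  simp only [Finset.mem_filter, Finset.mem_univ, true_and] at h
  by_cases hxy : x = y
  · exact ⟨15, by omega, by simp [err, hxy]⟩
  · obtain ⟨a, ha⟩ := Function.ne_iff.mp hxy
    refine ⟨a, by omega, ?_⟩
    funext b
    by_cases hb : b = a
    · subst hb
      have key : ∀ u v : ZMod 2, u ≠ v → v = u + 1 := by decide
      simpa [err] using key _ _ ha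
    · have : x b = y b := by
        by_contra hne; exact hb (h b hne a ha)
      simp [err, Pi.single_eq_of_ne hb, this]

theorem lin_lt (g : Good d) (x : F 15) : lin d.hc x < 2 ^ d.m := by
  have hb := g.h1b
  simp only [Dat.c1b, Bool.and_eq_true, allB_iff, Nat.blt_eq, Nat.beq_eq] at hb
  apply xorB_lt
  intro i hi
  split_ifs
  · exact hb.1.2 i hi
  · positivity

theorem code_perfect (g : Good d) : IsPerfectCode (code d) := by
  intro x
  obtain ⟨⟨⟨j, hj⟩, ⟨i, hi⟩⟩, hji⟩ := (pairMap_bij g).2 ⟨lin d.hc x, lin_lt g x⟩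
  have hji' : d.sc j ^^^ d.hc i = lin d.hc x := congrArg Fin.val hji
  refine ⟨x + err i, ⟨⟨j, hj, ?_⟩, dist_err x i⟩, ?_⟩
  · rw [lin_add, lin_err g hi, ← hji', Nat.xor_assoc, Nat.xor_self, Nat.xor_zero]
  · rintro y ⟨⟨j', hj', hy⟩, hd⟩
    obtain ⟨i', hi', rfl⟩ := exists_err hd
    rw [lin_add, lin_err g hi'] at hy
    have : d.sc j' ^^^ d.hc i' = d.sc j ^^^ d.hc i := by
      rw [← hy, hji', Nat.xor_assoc, Nat.xor_self, Nat.xor_zero]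
    rw [(pair_inj g hj' hj hi' hi this).2]

theorem sc_zero (g : Good d) : d.sc 0 = 0 := by
  have := g.h6
  simp only [Dat.c6, Bool.and_eq_true, Nat.beq_eq] at this
  exact this.1

theorem N_pos (d : Dat) : 0 < d.N := Nat.two_pow_pos _

theorem zero_mem_code (g : Good d) : (0 : F 15) ∈ code d :=
  ⟨0, N_pos d, by rw [xhom_zero (lin_add _), sc_zero g]⟩

theorem prm_zero (g : Good d) : prm d 0 = 1 := by
  have := g.h6
  simp only [Dat.c6, Bool.and_eq_true, Nat.beq_eq, allB_iff] at this
  ext i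
  rw [prm_val g (N_pos d), this.2 i i.isLt]
  rfl

/-- `(σ, π)` acts on the code at the level of syndromes. -/
def Act (d : Dat) (σ : ℕ) (π : Equiv.Perm (Fin 15)) : Prop :=
  ∃ A : ℕ → ℕ, (∀ y z, A (y ^^^ z) = A y ^^^ A z) ∧
    (∀ x, lin d.hc (permAct π x) = A (lin d.hc x)) ∧
    ∀ l < d.N, ∃ t < d.N, d.sc t = σ ^^^ A (d.sc l) ∧ prm d t = π * prm d l

theorem gen_facts (g : Good d) {b : ℕ} (hb : b < d.n) :
    (∀ x, lin d.hc (permAct (prm d (2 ^ b)) x) = d.aAct b (lin d.hc x)) ∧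
    ∀ l < d.N, d.mc b l < d.N ∧ d.sc (d.mc b l) = d.sc (2 ^ b) ^^^ d.aAct b (d.sc l) ∧
      prm d (d.mc b l) = prm d (2 ^ b) * prm d l := by
  have hbN : 2 ^ b < d.N := Nat.pow_lt_pow_right (by omega) hb
  have h3 := g.h3
  simp only [Dat.c3, allB_iff, Nat.beq_eq] at h3
  have h4 := g.h4
  simp only [Dat.c4, allB_iff, Nat.beq_eq, Bool.and_eq_true, Nat.blt_eq] at h4
  refine ⟨?_, ?_⟩
  · apply xhom_ext
    · intro x y; rw [permAct_add, lin_add]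
    · intro x y; rw [lin_add, aAct_xor]
    · intro i
      rw [permAct_single, lin_single, lin_single, prm_val g hbN, h3 b hb i i.isLt]
  · intro l hl
    obtain ⟨⟨ha, hs⟩, hp⟩ := h4 b hb l hl
    refine ⟨ha, hs, ?_⟩
    ext i
    rw [prm_val g ha, hp i i.isLt, Equiv.Perm.mul_apply, prm_val g hbN, prm_val g hl]

theorem act_all (g : Good d) (j : ℕ) : j < d.N → Act d (d.sc j) (prm d j) := by
  induction j using Nat.strong_induction_on with
  | _ j ih =>
    intro hj
    rcases Nat.eq_zero_or_pos j with rfl | hpos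
    · refine ⟨id, fun _ _ => rfl, ?_, ?_⟩
      · intro x; rw [prm_zero g]; rfl
      · intro l hl
        exact ⟨l, hl, by simp [sc_zero g], by rw [prm_zero g, one_mul]⟩
    · have hb1 : 2 ^ Nat.log2 j ≤ j := Nat.log2_self_le (by omega)
      have hb2 : j < 2 ^ (Nat.log2 j + 1) := Nat.lt_log2_self
      generalize Nat.log2 j = b at hb1 hb2
      have hb : b < d.n := by
        have : 2 ^ b < 2 ^ d.n := lt_of_le_of_lt hb1 hj
        exact (Nat.pow_lt_pow_iff_right (by omega)).mp this
      obtain ⟨l, rfl⟩ := Nat.exists_eq_add_of_le hb1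
      have hl : l < 2 ^ b := by rw [pow_succ] at hb2; omega
      have hlN : l < d.N := by omega
      have h5 := g.h5
      simp only [Dat.c5, allB_iff, Nat.beq_eq] at h5
      obtain ⟨f1, f2⟩ := gen_facts g hb
      obtain ⟨A, hA1, hA2, hA3⟩ := ih l (by have := Nat.two_pow_pos b; omega) hlN
      have e := f2 l hlN
      rw [h5 b hb l hl] at e
      refine ⟨fun y => d.aAct b (A y), ?_, ?_, ?_⟩
      · intro y z
        simp only [hA1, aAct_xor]
      · intro x
        rw [e.2.2, permAct_mul, f1, hA2]
      · intro k hk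
        obtain ⟨t, ht, hs, hp⟩ := hA3 k hk
        obtain ⟨h1, h2, h3⟩ := f2 t ht
        refine ⟨_, h1, ?_, ?_⟩
        · rw [h2, hs, e.2.1, aAct_xor, Nat.xor_assoc]
        · rw [h3, hp, e.2.2, mul_assoc]

open Classical in
/-- the propelinear structure -/
noncomputable def struc (d : Dat) (x : F 15) : Equiv.Perm (Fin 15) :=
  if h : ∃ j < d.N, lin d.hc x = d.sc j then prm d h.choose else 1

theorem struc_eq (g : Good d) {x : F 15} {j : ℕ} (hj : j < d.N) (hx : lin d.hc x = d.sc j) :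
    struc d x = prm d j := by
  have h : ∃ j < d.N, lin d.hc x = d.sc j := ⟨j, hj, hx⟩
  rw [struc, dif_pos h]
  congr 1
  exact sc_inj g h.choose_spec.1 hj (h.choose_spec.2.symm.trans hx)

theorem code_prop (g : Good d) : IsPropelinear (code d) := by
  have key : ∀ x ∈ code d, ∀ y ∈ code d, x + permAct (struc d x) y ∈ code d ∧
      struc d (x + permAct (struc d x) y) = struc d x * struc d y := by
    rintro x ⟨j, hj, hx⟩ y ⟨l, hl, hy⟩
    obtain ⟨A, -, h2, h3⟩ := act_all g j hj
    obtain ⟨t, ht, hs, hp⟩ := h3 l hl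
    have e : lin d.hc (x + permAct (struc d x) y) = d.sc t := by
      rw [struc_eq g hj hx, lin_add, h2, hx, hy, hs]
    exact ⟨⟨t, ht, e⟩, by rw [struc_eq g ht e, struc_eq g hj hx, struc_eq g hl hy, hp]⟩
  refine ⟨struc d, ?_, fun x hx y hy => (key x hx y hy).2⟩
  intro x hx
  unfold IsIsoPair
  have hinj : Function.Injective (fun y => x + permAct (struc d x) y) := by
    intro y z hyz
    have : permAct (struc d x) y = permAct (struc d x) z := add_left_cancel hyz
    funext i
    have := congrFun this (struc d x i)
    simpa [permAct] using this
  apply Set.eq_of_subset_of_ncard_le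
  · rintro _ ⟨y, hy, rfl⟩
    exact (key x hx y hy).1
  · rw [Set.ncard_image_of_injective _ hinj]
  · exact Set.toFinite _

/-- bit `b` of a xor-homomorphism as a linear functional -/
noncomputable def bitHom (f : F 15 → ℕ) (hf : ∀ x y, f (x + y) = f x ^^^ f y) (b : ℕ) :
    F 15 →ₗ[ZMod 2] ZMod 2 :=
  AddMonoidHom.toZModLinearMap 2
    { toFun := fun x => if (f x).testBit b then 1 else 0
      map_zero' := by simp [xhom_zero hf]
      map_add' := by
        intro x y
        have h11 : (1 : ZMod 2) + 1 = 0 := by decide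
        rw [hf, Nat.testBit_xor]
        cases (f x).testBit b <;> cases (f y).testBit b <;> simp [h11] }

theorem bitHom_apply (f : F 15 → ℕ) (hf : ∀ x y, f (x + y) = f x ^^^ f y) (b : ℕ) (x : F 15) :
    bitHom f hf b x = if (f x).testBit b then 1 else 0 := rfl

theorem code_rank (g : Good d) : codeRank (code d) = d.r := by
  have h7 := g.h7
  simp only [Dat.c7, allB_iff, Nat.beq_eq, Bool.and_eq_true, Nat.blt_eq, Nat.ble_eq] at h7
  obtain ⟨⟨hr, hs⟩, hi⟩ := h7
  have h8 := g.h8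
  simp only [Dat.c8, allB_iff, Nat.beq_eq, Bool.and_eq_true, Nat.blt_eq] at h8
  unfold codeRank
  apply le_antisymm
  · let Φ : F 15 →ₗ[ZMod 2] (Fin (15 - d.r) → ZMod 2) :=
      LinearMap.pi fun b => bitHom (lin d.hc) (lin_add _) (d.q + b)
    have hsub : Submodule.span (ZMod 2) (code d) ≤ LinearMap.ker Φ := by
      rw [Submodule.span_le]
      rintro x ⟨j, hj, hx⟩
      rw [SetLike.mem_coe, LinearMap.mem_ker]
      funext b
      rw [LinearMap.pi_apply, bitHom_apply, hx, Nat.testBit_lt_two_pow]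
      · simp
      · exact lt_of_lt_of_le (hs j hj) (Nat.pow_le_pow_right (by omega) (by omega))
    have hsurj : Function.Surjective Φ := by
      intro y
      refine ⟨∑ b : Fin (15 - d.r), y b • Pi.single (⟨d.icc b, (hi b b.isLt).1⟩ : Fin 15) 1, ?_⟩
      funext c
      rw [map_sum, Finset.sum_apply, Finset.sum_eq_single c]
      · have := (hi c c.isLt).2
        have h1 : (d.hc (d.icc c)).testBit (d.q + c) = true := by
          rw [← Nat.testBit_shiftRight, this]; simp
        rw [map_smul, Pi.smul_apply, LinearMap.pi_apply, bitHom_apply, lin_single, h1]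
        simp
      · intro b _ hbc
        have := (hi b b.isLt).2
        have h1 : (d.hc (d.icc b)).testBit (d.q + c) = false := by
          rw [← Nat.testBit_shiftRight, this, Nat.testBit_two_pow]
          simp only [decide_eq_false_iff_not]
          exact fun h => hbc (Fin.ext h)
        rw [map_smul, Pi.smul_apply, LinearMap.pi_apply, bitHom_apply, lin_single, h1]
        simp
      · simp
    have h1 := LinearMap.finrank_range_add_finrank_ker Φ
    rw [LinearMap.range_eq_top.mpr hsurj, finrank_top] at h1
    simp only [Module.finrank_fin_fun] at h1
    have h2 := Submodule.finrank_mono hsub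
    omega
  · let Ψ : F 15 →ₗ[ZMod 2] (Fin d.r → ZMod 2) :=
      LinearMap.pi fun b => bitHom (lin d.lc) (lin_add _) b
    have hsurj : Submodule.map Ψ (Submodule.span (ZMod 2) (code d)) = ⊤ := by
      rw [eq_top_iff]
      intro y _
      refine ⟨∑ a : Fin d.r, y a • vec (d.wc a), ?_, ?_⟩
      · apply Submodule.sum_mem
        intro a _
        apply Submodule.smul_mem
        apply Submodule.subset_span
        obtain ⟨⟨h1, h2⟩, -⟩ := h8 a a.isLt
        exact ⟨_, h1, by rw [lin_vec, h2]⟩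
      · funext c
        rw [map_sum, Finset.sum_apply, Finset.sum_eq_single c]
        · rw [map_smul, Pi.smul_apply, LinearMap.pi_apply, bitHom_apply, lin_vec,
            (h8 c c.isLt).2]
          simp
        · intro b _ hbc
          have h1 : (2 ^ (b : ℕ)).testBit c = false := by
            rw [Nat.testBit_two_pow]
            simp only [decide_eq_false_iff_not]
            exact fun h => hbc (Fin.ext h)
          rw [map_smul, Pi.smul_apply, LinearMap.pi_apply, bitHom_apply, lin_vec,
            (h8 b b.isLt).2, h1]
          simp
        · simp
    have h1 := Submodule.finrank_map_le Ψ (Submodule.span (ZMod 2) (code d))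
    rw [hsurj, finrank_top, Module.finrank_fin_fun] at h1
    exact h1

theorem final (g : Good d) : ∃ C : Set (F 15),
    IsPerfectCode C ∧ (0 : F 15) ∈ C ∧ IsPropelinear C ∧ codeRank C = d.r :=
  ⟨code d, code_perfect g, zero_mem_code g, code_prop g, code_rank g⟩

end

def dat11 : Dat where
  n := 0
  m := 4
  r := 11
  q := 0
  h := 26960769438260988735041015629245507251263403350083825995293393747980
  s := 0
  p := 1070935975390360080
  a := 0
  mu := 0
  ic := 31710
  w := 23949810153846152414724575170232059333659828627374095
  wi := 0
  l := 27607196013352542568429273306234766808940856641066789819397910122463232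

def dat12 : Dat where
  n := 2
  m := 6
  r := 12
  q := 3
  h := 80884365189204718980551055796429413568566897928175857931517762338865
  s := 562971428519936
  p := 6695533685154664731742486660260299926016545496512731294693560850461433803280
  a := 2239813094121475492785192122897218461440770363085803476371775376096241735831661615424864113744777641986
  mu := 3016167024901604822745957428078558593429614710101631448504408073643302626407233882427098974596671125656848974994887919555292167518111518690352279291405067906172448427131885163849004772238632549690866153426920897599485728414232289430888973533870451813545374581358839327661659533094369541446499340803446617835105878017
  ic := 2973
  w := 1569574758242461443290270675187066920574134632814661140495
  wi := 2427296517155714469396992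
  l := 55591837039311146059159091646655331175140215561198004692264759520526336

def dat13 : Dat where
  n := 3
  m := 7
  r := 13
  q := 5
  h := 700979182403967985426415315801220318162608827950790224010507693719649
  s := 83077858965891696356941492134805504
  p := 778385702385272193415049222307289543321187146654180253826038566805210166870240978874284238816182762445824150058068563675973380486008184780271578812527120
  a := 72235707155368672659347153996240374352722312726336521432329212304810132619697987613315917643145203035992890551909006064977148549728210131596703326007248867860943799876681655750732742676
  mu := 7004285505817928750298344681619859040002554900015865438602934462768686461477058713861863928938148886827441518116047120287816141015705945907675222986192020427608460033180065891751455657598568538169716213926108823218636929636100527400942016866738221174302482238326134410879782462282948085271202642625519770920742580603096187752023074539642592754267989433797813474274486048748078624504916352688700128827915996242191155311528938999399028525791104991701902514776227591338147006251506723734291438903674587865393975501860780295218612461437902209753011000807916601325525502884902087694174383845506550563993283076221502643132988595839109890049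
  ic := 125
  w := 102920145176016923115050673139990101737041647387594379076960285
  wi := 317538878446724025744917333253
  l := 112693419573758406694918277669208346122136925274421068219832651832426496

def dat14 : Dat where
  n := 5
  m := 9
  r := 14
  q := 8
  h := 2588247029105144931777000614555334693907701473365156710400179658948865
  s := 17185675304758145640788692703802435279013852063745151665950953249060746811033015911156990651769112858885228453421775107650886564845436113453897313157120
  p := 1868690719259829165261003752822318470615478898994627177104892819597680017496819856255003295000327564199451451469279184783443057419915118742419166004839138762087818744901774453749317493102830243275728278184076639901950848500226874493286942731344358214618847448574129245171259543667610966485368897318539501230815001350875556015614364169240066886817513661447859312700287636263768186627935629864615087958754358279530537115795705120283466381460324802538923564677389225563619711443441103951147087446504920827135720903768612368347994251513862351875870420392345718273951444808503301931091617525368387627347737306097176031760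
  a := 15904924625798155794941380014585489955309530166850468402920819786822377954677638128501766408920291539900528626142985082373986039615602971679261243488542387009508268383672932460662608491013748276277267018293704107373539826875425479678642841124902404487949159576542986368005009257620240692557707705969984542174119076809374000174446545983075802501218305
  mu := 7111785550211782080741236119368454693864165187923789705233029102524822864055104249441237155588373208000950503097016762330480336183339726577389953022885165341197366381560204231759006277739768107507004104077246926612851545225273602495492128680749506443011969650658261210079324657731783461450045980800277525572383729445945064423121619925706410712444010251478822014479505255957945293766772988364859561745844330115634547087172586790240868563824878081002941667263729640532688547228698209714398643558559548893872082779229008737977961918899861951202072065147374542909580370698832688485532820347054041522369144601257462431478955141514072661825820258734149682478921188007693460882886129644167547119503519698559919010231277241480011880266113020221255948073983173486998509500745962184729949731009891513815737176586393965512324624171958273208397589371019705998251754680872649233461399314842955872884752775835025471969325654150565851878802762015696837884849628106703484396811039376640610724720937461876462667489182899531741928730137214893210841699996498632326725707100622677094101559891906447634442069007258247604238180909162451716788948887488336636851676419984594544086455401547643767066558816601704788651535332264485115117837549183612225351815854730635888610840530572662319601947702728275470950240560654548303483624423425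
  ic := 7
  w := 6742095064075385905709372466774720774005341960179373503209290924062
  wi := 569498541014403996044343147365380
  l := 304109964457417947227578581359700448960190094626919823459072915049349120

def dat15 : Dat where
  n := 7
  m := 11
  r := 15
  q := 11
  h := 41410899333123975952122598915418720536069019721008196512846780391620609
  s := 749545112726510529746688596744894003184216594679185641494700313937517484615380414630467889459209771311601547375914431236269228274360550063018470150858181599446273422528429469267150067154199894304483523947746013569595612111146965783557652997090818278719006535406257828358925715653469775149399306969770450730698545994430668613662379381151645833313603141573518025661146257699557284931592829157603375497021680568098990277893151128843223942154717572955860780671944525853213771477946157731128741577125072972298351383744979424033748267791491788169559376182132138310154495853975318509731916499327543860306422525815032905728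
  p := 6307115949932944638556614532699490861339942370401687028843407825144766398130671953320457831792392692878434064622860876048750896418937542653834947338732071669099527279075967877421364861739470541467533881507575823045090864808206334434549331169615502801366910704259191081210991975577405263476869736878398877259559235889006954690273217939048748838324777523086502458007914867758871460425109071778424486500915614211601518589784937055766678373417690317882916342727260695502195725692647283474556706823282156945481596826969317128171087110010837926034639679465000750377291542972705048457964170469596210868413509871219048097812906125611557158828338131275287872524195565534819379254267096313280252449956696188695710370569908392945173814977663236138522857302550072124160609636144390776189737516219982410985052395209995053761891615663283039915546666278842296618034765359410424033371383270984695383466942961736047953289113115606760768071666432605390412708460129401062112164905870761448499540157753235779068281399275762422342377805276778086491846633813023987516054112024788658392728956044014692328539052031353428357363427814363362715728121678518672476106582699957195216411170851522560962386778713049716327188681927180376013862306970403878929198697359141506312432022664156510916421192077862874863734271988523691527860908072222364670190066292370233194953342911916955316540967315985280389346568141436983540739201847942830529496108672352054798263967490692276044105130218253311847246235395982825524459460364729363035888716326156094669492669396270776475105419215151552829547436962228675873575232630007318586230342047171961303834169311152780442263501103958898558769226295664448023160965763721347006887077924343082923886126335332960823707157539335049858497806772616185162526180531286143098676149531196732431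8923936066381336868595486394782947279389245974406553162962994630775766954248895563921803783440323013158126279816136628938727412690782570233647801308462016190129034382801203886134467991817588199423991456449418759307346414402032406240318409021802963119967747616512888297571082994158240975789244723529666836789695994031780823806878374244676658834361264316072181696052175907845591259062599643684463690763530163837634322525915459435641203223402920733068362778888782997403406257541575540399575519242677411184418278726141265175921978049209640761329700113763677406322194231031538455425625396509632015798146774957133149794169552743401930302962451911820473755826276721834853445035643712582160
  a := 1803664928086190716849348762566886137111747320957612072283371219189167672537417101438325084172479043264715689244455332490790999768024630042208798914851840410599863075082656027075471484464018118347313988285216516486903433308809183256193330246295515009978505975158900796136434371356492504093754350045413227136510345358814525490351469209068347682028270712056780493056164507168704053590473937489970338538302336028737859126780568555237521859597955280284798495219489012342053467457391608186189079219930664343522657828865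
  mu := 1498933113992070068315622105802179604373828017149992000337835260037817401681454514246670445982405922364779035377363243113571674704337325378931248764182320927036864769808611917372355483813010542467088994539037279678318557325308203456096650296003248215959391290314787546446047600570728320414738256707991697935454751623037583373780649634764937580716214590809661899358821888947234649112469056888054460006496891620508252256051398519492165815324900130630062564928314588697240098014502516080043658090500259337928199996341398524390178294852799816980095189564484547826138794288737983462152779409879656344207057838687691806052009689009872150517608749607205900910915078674338441765123478874046052209061786525645199091934065398458116102567664843696253517313653041880388589290822311802303165578540734027452823924192795517931013648674833006579332932346030635661059200025102546448899066917359180328178451278850231272738828905426150372277091946541768238463922975661260854488026393383733531217524546773241943508859479342620606442841657774225520810661769631075371864483968426402321947729390466140838712691497154460648202448623605313956270783668622819348203250524709818344543524793867656139826243034992777581054667498446344828618451659510190960307348093018014838890719304485814251431358756765201821270614772076261391098556799410157270605060712333532562526696649530950404021817330205190651918355293374088290845989455537373263263135547500226042854000404952505522053376536743262891912247033929610423259862846385027980488171359977533026802023127344127746805950830865305799581419788682350226049837412388761181531520515752560336712189277400038242076133581763748503915854550158957800247594371381811976547693706707664887122502226572781862674604000421036173075415135135692307480537675230249345349101268265622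599202728616279064241583154070896148540829425535357419845186301274049498131866945925252947576400056217052351541165742481673160928392645263849260904502377367246471228494781320008279415987720458464074579683549814062376078823704017975826697898840231681951888125894634551105845431102610989473502278196662203517610839820435442787984152231123850509791615795253120868468397102074101761
  ic := 0
  w := 441849945408734351440521326156026064621405974735644199248849256897052687
  wi := 249962036793007981675528526952669696
  l := 444358029637854536224349182818722276951853719489290565373418733178192266

theorem good11 : Good dat11 := ⟨by decide +kernel, by decide +kernel, by decide +kernel, by decide +kernel,
  by decide +kernel, by decide +kernel, by decide +kernel, by decide +kernel, by decide +kernel,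
  by decide +kernel⟩

theorem good12 : Good dat12 := ⟨by decide +kernel, by decide +kernel, by decide +kernel, by decide +kernel,
  by decide +kernel, by decide +kernel, by decide +kernel, by decide +kernel, by decide +kernel,
  by decide +kernel⟩

theorem good13 : Good dat13 := ⟨by decide +kernel, by decide +kernel, by decide +kernel, by decide +kernel,
  by decide +kernel, by decide +kernel, by decide +kernel, by decide +kernel, by decide +kernel,
  by decide +kernel⟩

theorem good14 : Good dat14 := ⟨by decide +kernel, by decide +kernel, by decide +kernel, by decide +kernel,
  by decide +kernel, by decide +kernel, by decide +kernel, by decide +kernel, by decide +kernel,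
  by decide +kernel⟩

theorem good15 : Good dat15 := ⟨by decide +kernel, by decide +kernel, by decide +kernel, by decide +kernel,
  by decide +kernel, by decide +kernel, by decide +kernel, by decide +kernel, by decide +kernel,
  by decide +kernel⟩

end PropCode

/-- For every `r ∈ {11,...,15}` there is a propelinear perfect binary code of
length `15` containing `0` with rank `r`. -/
theorem propelinear_perfect_length_15_all_ranks
    (r : ℕ) (hr : r ∈ ({11, 12, 13, 14, 15} : Set ℕ)) :
    ∃ C : Set (F 15),
      IsPerfectCode C ∧ (0 : F 15) ∈ C ∧ IsPropelinear C ∧ codeRank C = r := by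
  simp only [Set.mem_insert_iff, Set.mem_singleton_iff] at hr
  rcases hr with rfl | rfl | rfl | rfl | rfl
  · exact PropCode.final PropCode.good11
  · exact PropCode.final PropCode.good12
  · exact PropCode.final PropCode.good13
  · exact PropCode.final PropCode.good14
  · exact PropCode.final PropCode.good15
end
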